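/- arXiv:math/0209279 — 7 statements merged into one kernel-verified Lean document; each statement's English description precedes it below -/
import Mathlib

section
/- (Basarab) Let Q be a CC-loop with nucleus N(Q). Then for all x, y, z ∈ Q, both the associator (x·(y·z)) \ ((x·y)·z) and the commutator (x·y) \ (y·x) belong to N(Q). (This expresses that the quotient Q/N(Q) is an abelian group.) -/
/-- A loop: a type with multiplication, identity, and two-sided division. -/
class Loop (Q : Type*) extends Mul Q, One Q where
  ld : Q → Q → Q  -- left division: `ld x y = x \ y`
  rd : Q → Q → Q  -- right division: `rd x y = x / y`
  one_mul : ∀ x : Q, 1 * x = x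
  mul_one : ∀ x : Q, x * 1 = x
  mul_ld : ∀ x y : Q, x * ld x y = y
  ld_mul : ∀ x y : Q, ld x (x * y) = y
  rd_mul : ∀ x y : Q, rd x y * y = x
  mul_rd : ∀ x y : Q, rd (x * y) y = x

namespace Loop

variable {Q : Type*} [Loop Q]

/-- A conjugacy closed loop (CC-loop). -/
def IsCC (Q : Type*) [Loop Q] : Prop :=
  (∀ x y z : Q, x * (y * z) = rd (x * y) x * (x * z)) ∧
  (∀ x y z : Q, (z * y) * x = (z * x) * ld x (y * x))

/-- The nucleus `N(Q)`. -/
def nucleus (Q : Type*) [Loop Q] : Set Q :=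
  {a | (∀ x y : Q, a * (x * y) = (a * x) * y) ∧
       (∀ x y : Q, x * (a * y) = (x * a) * y) ∧
       (∀ x y : Q, x * (y * a) = (x * y) * a)}

/-- A subloop: contains 1 and is closed under `·`, `\`, `/`. -/
def IsSubloop (S : Set Q) : Prop :=
  (1 : Q) ∈ S ∧ (∀ a ∈ S, ∀ b ∈ S, a * b ∈ S) ∧
  (∀ a ∈ S, ∀ b ∈ S, ld a b ∈ S) ∧ (∀ a ∈ S, ∀ b ∈ S, rd a b ∈ S)

/-- The subloop generated by a set `S`. -/
def closure (S : Set Q) : Set Q := ⋂₀ {T : Set Q | IsSubloop T ∧ S ⊆ T}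

/-- An element is power-associative if the subloop it generates is associative. -/
def IsPA (a : Q) : Prop :=
  ∀ x ∈ closure {a}, ∀ y ∈ closure {a}, ∀ z ∈ closure {a}, x * (y * z) = (x * y) * z

/-- Powers: `pow a 0 = 1`, `pow a (n+1) = a * pow a n`. -/
def pow (a : Q) : ℕ → Q
  | 0 => 1
  | n + 1 => a * pow a n

/-- A WIP (weak inverse property) element. -/
def IsWIP (c : Q) : Prop := ∀ x : Q, c * ld (x * c) 1 = ld x 1

end Loop

open Loop

namespace Loop

/-- abstract bimodule computation -/
theorem abs_key {Q A : Type*} [AddCommGroup A] (mul : Q → Q → Q) (lam rho : Q → A →+ A)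
    (F : Q → Q → A)
    (hI : ∀ x y v, F (mul x y) v = lam x (F y v) + F x v - F x y + rho v (F x y))
    (hII : ∀ x y v, F x (mul y v) = lam x (F y v) - F y v + F x v + rho v (F x y))
    (hIII : ∀ x y, ∃ x', F y x = F x' y ∧
      ∀ v, lam y (F x v) = lam x' (F y v) - F y v + F x' v)
    (hV : ∀ y v x z, lam y (rho v (F x z) - F x z) = rho v (F x z) - F x z)
    (hV' : ∀ y v x z, rho v (lam y (F x z) - F x z) = lam y (F x z) - F x z)
    (hinj : ∀ w a b, rho w a = rho w b → a = b) :
    (∀ x v w, rho w (F x v) - F x v = rho w (F v x) - F v x) ∧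
    (∀ x y c, mul c (mul x y) = mul y x → ∀ v w, rho w (F c v) = F c v) := by
  have s2 : ∀ x v w, rho w (F x v) - F x v = rho w (F v x) - F v x := by
    intro x v w
    obtain ⟨v', h1, h2⟩ := hIII v x
    have h3 := h2 x
    rw [h1]
    have e1 := congrArg (rho w) h3
    have e2 := hV' v' w x x
    have e3 := hV x w v x
    have e4 := hV' x w v x
    simp only [map_add, map_sub] at e1 e2 e3 e4
    have : rho w (F v' x) = rho w (lam x (F v x)) - rho w (lam v' (F x x)) + rho w (F x x) := by
      rw [e1]; abel
    have q : F v' x = (lam x (F v x)) - (lam v' (F x x)) + (F x x) := by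
      rw [h3]; abel
    rw [this, q]
    grind
  have s3 : ∀ x y v w, rho w (F (mul x y) v) - F (mul x y) v =
      (rho w (F y v) - F y v) + (rho w (F x v) - F x v) +
       (rho w (rho v (F x y) - F x y) - (rho v (F x y) - F x y)) := by
    intro x y v w
    have e2 := hV' x w y v
    rw [hI]
    simp only [map_add, map_sub] at *
    grind
  have s3' : ∀ x y v w, rho w (F (mul x y) v) - F (mul x y) v =
      rho w (F (mul y x) v) - F (mul y x) v := by
    intro x y v w
    rw [s3, s3, s2 x y v]
    abel
  have s3'' : ∀ x y v w, rho w (F x (mul y v)) - F x (mul y v) =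
      rho w (F x v) - F x v + (rho w (rho v (F x y)) - rho v (F x y)) := by
    intro x y v w
    have e2 := hV' x w y v
    rw [hII]
    simp only [map_add, map_sub] at *
    grind
  have s4 : ∀ x y v w, rho w (rho v (F x y) - F x y) - (rho v (F x y) - F x y) =
      rho w (rho y (F x v) - F x v) - (rho y (F x v) - F x v) := by
    intro x y v w
    have e1 := s3'' x y v w
    have e2 := s3'' x v y w
    have e3 := s2 x (mul y v) w
    have e4 := s2 x (mul v y) w
    have e5 := s3' y v x w
    simp only [map_add, map_sub] at *
    grind
  refine ⟨s2, ?_⟩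
  intro x y c hc v
  have key : ∀ w, rho w (rho (mul x y) (F c v)) = rho (mul x y) (F c v) := by
    intro w
    have e1 := s3 c (mul x y) v w
    rw [hc, s3' y x, s4 c (mul x y) v w] at e1
    simp only [map_add, map_sub] at *
    grind
  have k2 := hinj _ _ _ (key (mul x y))
  intro w
  have := key w
  rw [k2] at this
  exact this

section
variable {Q : Type*} [Loop Q]

def LL (x : Q) : Equiv.Perm Q := ⟨fun y => x * y, fun y => ld x y, fun y => ld_mul x y, fun y => mul_ld x y⟩
def RR (x : Q) : Equiv.Perm Q := ⟨fun y => y * x, fun y => rd y x, fun y => mul_rd y x, fun y => rd_mul y x⟩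
theorem LL_apply (x y : Q) : LL x y = x * y := rfl
theorem RR_apply (x y : Q) : RR x y = y * x := rfl
theorem LL_inj {x y : Q} (h : LL x = LL y) : x = y := by
  have := congrArg (fun e : Equiv.Perm Q => e 1) h
  simpa [LL_apply, Loop.mul_one] using this
theorem RR_inj {x y : Q} (h : RR x = RR y) : x = y := by
  have := congrArg (fun e : Equiv.Perm Q => e 1) h
  simpa [RR_apply, Loop.one_mul] using this

def FF (x v : Q) : Equiv.Perm Q := LL x * RR v * (LL x)⁻¹ * (RR v)⁻¹

theorem conjL (hcc : IsCC Q) (x y : Q) : LL x * LL y * (LL x)⁻¹ = LL (rd (x * y) x) := by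
  rw [mul_inv_eq_iff_eq_mul]
  ext z
  exact hcc.1 x y z
theorem conjR (hcc : IsCC Q) (x y : Q) : RR x * RR y * (RR x)⁻¹ = RR (ld x (y * x)) := by
  rw [mul_inv_eq_iff_eq_mul]
  ext z
  exact hcc.2 x y z
theorem FF_R (hcc : IsCC Q) (x v : Q) : RR (x * v) = FF x v * RR v * RR x := by
  have : RR (x * v) * (RR x)⁻¹ * LL x = LL x * RR v := by
    ext u
    have h := hcc.1 x u v
    exact h.symm
  have h2 : RR (x*v) = LL x * RR v * (LL x)⁻¹ * RR x := by
    rw [← this]; group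
  rw [h2, FF]; group
theorem FF_L (hcc : IsCC Q) (x v : Q) : LL x * LL v = FF x v * LL (x * v) := by
  have : LL (x * v) * (LL v)⁻¹ * RR v = RR v * LL x := by
    ext u
    have h := hcc.2 v u x
    exact h.symm
  have h2 : LL (x*v) = RR v * LL x * (RR v)⁻¹ * LL v := by
    rw [← this]; group
  rw [h2, FF]; group

def GrL (Q : Type*) [Loop Q] : Subgroup (Equiv.Perm Q) := Subgroup.closure (Set.range (LL (Q := Q)))
def GrR (Q : Type*) [Loop Q] : Subgroup (Equiv.Perm Q) := Subgroup.closure (Set.range (RR (Q := Q)))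
theorem LL_mem (x : Q) : LL x ∈ GrL Q := Subgroup.subset_closure ⟨x, rfl⟩
theorem RR_mem (x : Q) : RR x ∈ GrR Q := Subgroup.subset_closure ⟨x, rfl⟩

theorem conj_clos {G : Type*} [Group G] (s : Set G) (g : G)
    (h : ∀ a ∈ s, g * a * g⁻¹ ∈ Subgroup.closure s) :
    ∀ a ∈ Subgroup.closure s, g * a * g⁻¹ ∈ Subgroup.closure s := by
  intro a ha
  induction ha using Subgroup.closure_induction with
  | mem a ha => exact h a ha
  | one => simp
  | mul a b _ _ h1 h2 =>
    have : g * (a * b) * g⁻¹ = (g * a * g⁻¹) * (g * b * g⁻¹) := by group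
    rw [this]; exact mul_mem h1 h2
  | inv a _ h1 =>
    have : g * a⁻¹ * g⁻¹ = (g * a * g⁻¹)⁻¹ := by group
    rw [this]; exact inv_mem h1

theorem comm_clos {G : Type*} [Group G] (s : Set G) (g : G)
    (h : ∀ a ∈ s, g * a = a * g) :
    ∀ a ∈ Subgroup.closure s, g * a = a * g := by
  intro a ha
  have : s ⊆ (Subgroup.centralizer {g} : Subgroup G) := by
    intro b hb
    rw [SetLike.mem_coe, Subgroup.mem_centralizer_singleton_iff]
    first | exact h b hb | exact (h b hb).symm
  have := (Subgroup.closure_le _).2 this ha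
  rw [Subgroup.mem_centralizer_singleton_iff] at this
  first | exact this | exact this.symm

theorem FF_mem_L (hcc : IsCC Q) (x v : Q) : FF x v ∈ GrL Q := by
  rw [← mul_inv_eq_iff_eq_mul.2 (FF_L hcc x v)]
  exact mul_mem (mul_mem (LL_mem _) (LL_mem _)) (inv_mem (LL_mem _))
theorem FF_mem_R (hcc : IsCC Q) (x v : Q) : FF x v ∈ GrR Q := by
  have : FF x v = RR (x * v) * (RR x)⁻¹ * (RR v)⁻¹ := by rw [FF_R hcc]; group
  rw [this]
  exact mul_mem (mul_mem (RR_mem _) (inv_mem (RR_mem _))) (inv_mem (RR_mem _))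

theorem LL_one : LL (1 : Q) = 1 := by ext y; exact Loop.one_mul y
theorem RR_one : RR (1 : Q) = 1 := by ext y; exact Loop.mul_one y

theorem nLR (hcc : IsCC Q) (v : Q) : ∀ a ∈ GrL Q, RR v * a * (RR v)⁻¹ ∈ GrL Q := by
  apply conj_clos
  rintro _ ⟨u, rfl⟩
  have : RR v * LL u * (RR v)⁻¹ = (FF u v)⁻¹ * LL u := by rw [FF]; group
  rw [this]
  exact mul_mem (inv_mem (FF_mem_L hcc _ _)) (LL_mem _)
theorem nRL (hcc : IsCC Q) (v : Q) : ∀ a ∈ GrR Q, LL v * a * (LL v)⁻¹ ∈ GrR Q := by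
  apply conj_clos
  rintro _ ⟨u, rfl⟩
  have : LL v * RR u * (LL v)⁻¹ = FF v u * RR u := by rw [FF]; group
  rw [this]
  exact mul_mem (FF_mem_R hcc _ _) (RR_mem _)
theorem nLR' (hcc : IsCC Q) (v : Q) : ∀ a ∈ GrL Q, (RR v)⁻¹ * a * (RR v)⁻¹⁻¹ ∈ GrL Q := by
  have key : ∀ u, (RR v)⁻¹ * (LL (u * v) * (LL v)⁻¹) * RR v = LL u := by
    intro u
    have h := FF_L hcc u v
    have : LL (u * v) * (LL v)⁻¹ = (FF u v)⁻¹ * LL u := by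
      rw [mul_inv_eq_iff_eq_mul, mul_assoc, h]; group
    rw [this, FF]; group
  apply conj_clos
  rintro _ ⟨u, rfl⟩
  have h1 := key (rd u v)
  have h2 := key (rd 1 v)
  rw [rd_mul] at h1 h2
  rw [LL_one] at h2
  have : (RR v)⁻¹ * LL u * (RR v)⁻¹⁻¹ = LL (rd u v) * (LL (rd 1 v))⁻¹ := by
    rw [← h1, ← h2]; group
  rw [this]
  exact mul_mem (LL_mem _) (inv_mem (LL_mem _))
theorem nRL' (hcc : IsCC Q) (v : Q) : ∀ a ∈ GrR Q, (LL v)⁻¹ * a * (LL v)⁻¹⁻¹ ∈ GrR Q := by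
  have key : ∀ u, (LL v)⁻¹ * (RR (v * u) * (RR v)⁻¹) * LL v = RR u := by
    intro u
    rw [FF_R hcc v u, FF]; group
  apply conj_clos
  rintro _ ⟨u, rfl⟩
  have h1 := key (ld v u)
  have h2 := key (ld v 1)
  rw [mul_ld] at h1 h2
  rw [RR_one] at h2
  have : (LL v)⁻¹ * RR u * (LL v)⁻¹⁻¹ = RR (ld v u) * (RR (ld v 1))⁻¹ := by
    rw [← h1, ← h2]; group
  rw [this]
  exact mul_mem (RR_mem _) (inv_mem (RR_mem _))

def DD (Q : Type*) [Loop Q] : Subgroup (Equiv.Perm Q) := GrL Q ⊓ GrR Q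

theorem DD_L (hcc : IsCC Q) (v : Q) {a} (h : a ∈ DD Q) : LL v * a * (LL v)⁻¹ ∈ DD Q :=
  ⟨(GrL Q).mul_mem ((GrL Q).mul_mem (LL_mem _) h.1) ((GrL Q).inv_mem (LL_mem _)), nRL hcc v a h.2⟩
theorem DD_R (hcc : IsCC Q) (v : Q) {a} (h : a ∈ DD Q) : RR v * a * (RR v)⁻¹ ∈ DD Q :=
  ⟨nLR hcc v a h.1, (GrR Q).mul_mem ((GrR Q).mul_mem (RR_mem _) h.2) ((GrR Q).inv_mem (RR_mem _))⟩
theorem DD_L' (hcc : IsCC Q) (v : Q) {a} (h : a ∈ DD Q) : (LL v)⁻¹ * a * LL v ∈ DD Q :=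
  ⟨(GrL Q).mul_mem ((GrL Q).mul_mem ((GrL Q).inv_mem (LL_mem _)) h.1) (LL_mem _), by simpa using nRL' hcc v a h.2⟩
theorem DD_R' (hcc : IsCC Q) (v : Q) {a} (h : a ∈ DD Q) : (RR v)⁻¹ * a * RR v ∈ DD Q :=
  ⟨by simpa using nLR' hcc v a h.1, (GrR Q).mul_mem ((GrR Q).mul_mem ((GrR Q).inv_mem (RR_mem _)) h.2) (RR_mem _)⟩
theorem FF_mem (hcc : IsCC Q) (x v : Q) : FF x v ∈ DD Q := ⟨FF_mem_L hcc _ _, FF_mem_R hcc _ _⟩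

/- nucleus -/
theorem FF_one_iff (x v : Q) : FF x v = 1 ↔ LL x * RR v = RR v * LL x := by
  rw [FF, mul_inv_eq_one, mul_inv_eq_iff_eq_mul]

theorem mid_nuc (hcc : IsCC Q) {n : Q} (h : ∀ w v, w * (n * v) = (w * n) * v) : n ∈ nucleus Q := by
  refine ⟨?_, h, ?_⟩
  · intro x y
    have : FF n y = 1 := by
      have h1 := FF_R hcc n y
      have h2 : RR (n * y) = RR y * RR n := by ext w; exact h w y
      rw [h2, mul_assoc] at h1
      exact (right_eq_mul.1 h1)
    rw [FF_one_iff] at this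
    exact congrArg (fun e : Equiv.Perm Q => e x) this
  · intro x y
    have : FF x n = 1 := by
      have h1 := FF_L hcc x n
      have h2 : LL x * LL n = LL (x * n) := by ext w; exact h x w
      rw [h2] at h1
      exact (right_eq_mul.1 h1)
    rw [FF_one_iff] at this
    exact congrArg (fun e : Equiv.Perm Q => e y) this

theorem nuc_of_FF (hcc : IsCC Q) {n : Q} (h : ∀ v, FF n v = 1) : n ∈ nucleus Q := by
  apply mid_nuc hcc
  intro w v
  have h1 := FF_R hcc n v
  rw [h, _root_.one_mul] at h1
  exact congrArg (fun e : Equiv.Perm Q => e w) h1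

theorem auL (hcc : IsCC Q) : ∀ g ∈ GrL Q, ∃ α : Equiv.Perm Q, ∀ u v, α u * g v = g (u * v) := by
  intro g hg
  induction hg using Subgroup.closure_induction with
  | mem a ha =>
    obtain ⟨x, rfl⟩ := ha
    exact ⟨(RR x)⁻¹ * LL x, fun u v => (hcc.1 x u v).symm⟩
  | one => exact ⟨1, fun u v => rfl⟩
  | mul a b _ _ h1 h2 =>
    obtain ⟨α, h1⟩ := h1
    obtain ⟨β, h2⟩ := h2
    exact ⟨α * β, fun u v => by simp [Equiv.Perm.mul_apply, h1, h2]⟩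
  | inv a _ h1 =>
    obtain ⟨α, h1⟩ := h1
    refine ⟨α⁻¹, fun u v => ?_⟩
    rw [Equiv.Perm.eq_inv_iff_eq, ← h1]; simp
theorem auR (hcc : IsCC Q) : ∀ g ∈ GrR Q, ∃ α : Equiv.Perm Q, ∀ u v, g u * α v = g (u * v) := by
  intro g hg
  induction hg using Subgroup.closure_induction with
  | mem a ha =>
    obtain ⟨x, rfl⟩ := ha
    exact ⟨(LL x)⁻¹ * RR x, fun u v => (hcc.2 x v u).symm⟩
  | one => exact ⟨1, fun u v => rfl⟩
  | mul a b _ _ h1 h2 =>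
    obtain ⟨α, h1⟩ := h1
    obtain ⟨β, h2⟩ := h2
    exact ⟨α * β, fun u v => by simp [Equiv.Perm.mul_apply, h1, h2]⟩
  | inv a _ h1 =>
    obtain ⟨α, h1⟩ := h1
    refine ⟨α⁻¹, fun u v => ?_⟩
    rw [Equiv.Perm.eq_inv_iff_eq, ← h1]; simp

theorem DD_one (hcc : IsCC Q) {S : Equiv.Perm Q} (h : S ∈ DD Q) : S 1 ∈ nucleus Q := by
  obtain ⟨α, ha⟩ := auL hcc S h.1
  obtain ⟨β, hb⟩ := auR hcc S h.2
  apply mid_nuc hcc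
  intro w v
  obtain ⟨u, rfl⟩ := α.surjective w
  obtain ⟨t, rfl⟩ := β.surjective v
  rw [hb, ha, ha, hb, Loop.one_mul, Loop.mul_one]

theorem DD_at (hcc : IsCC Q) {S : Equiv.Perm Q} (h : S ∈ DD Q) (u : Q) :
    ∃ n ∈ nucleus Q, S u = u * n := by
  refine ⟨_, DD_one hcc (DD_L' hcc u h), ?_⟩
  simp only [Equiv.Perm.mul_apply]
  rw [← LL_apply u, LL_apply u 1, Loop.mul_one]
  simp

theorem nuc_commR {c : Q} (h : c ∈ nucleus Q) : ∀ a ∈ GrR Q, LL c * a = a * LL c := by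
  apply comm_clos
  rintro _ ⟨v, rfl⟩
  ext x
  exact h.1 x v
theorem nuc_commL {c : Q} (h : c ∈ nucleus Q) : ∀ a ∈ GrL Q, RR c * a = a * RR c := by
  apply comm_clos
  rintro _ ⟨v, rfl⟩
  ext x
  exact (h.2.2 v x).symm

/-- decomposition of an element of D -/
theorem DD_dec (hcc : IsCC Q) {S : Equiv.Perm Q} (h : S ∈ DD Q) :
    ∃ c ∈ nucleus Q, ∃ k : Equiv.Perm Q, S = RR c * k ∧ (∀ u v, k (u * v) = k u * k v) ∧
      ∀ u, ∃ m ∈ nucleus Q, k u = u * m := by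
  have hc := DD_one hcc h
  have hk : (RR (S 1))⁻¹ * S ∈ GrR Q := mul_mem (inv_mem (RR_mem _)) h.2
  have k1 : ((RR (S 1))⁻¹ * S) 1 = 1 := by
    rw [Equiv.Perm.mul_apply, Equiv.Perm.inv_eq_iff_eq, RR_apply, Loop.one_mul]
  refine ⟨S 1, hc, (RR (S 1))⁻¹ * S, by group, ?_, ?_⟩
  · obtain ⟨α, ha⟩ := auR hcc _ hk
    intro u v
    have := ha 1 v
    rw [k1, Loop.one_mul, Loop.one_mul] at this
    rw [← ha, this]
  · intro u
    obtain ⟨n, hn, e⟩ := DD_at hcc h u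
    have hS := DD_one hcc h
    set c := S 1
    refine ⟨rd n c, ?_, ?_⟩
    · set m := rd n c with hm
      have hmc : m * c = n := rd_mul n c
      apply mid_nuc hcc
      intro w v
      obtain ⟨t, rfl⟩ : ∃ t, v = c * t := ⟨_, (mul_ld c v).symm⟩
      rw [hS.2.1 m t, hmc, hn.2.1, hS.2.1, ← hS.2.2, hmc]
    · rw [Equiv.Perm.mul_apply, e, Equiv.Perm.inv_eq_iff_eq, RR_apply, ← hS.2.2, rd_mul]

theorem aut_L {k : Equiv.Perm Q} (hk : ∀ u v, k (u * v) = k u * k v) (u : Q) :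
    k * LL u = LL (k u) * k := by
  ext v; exact hk u v
theorem aut_R {k : Equiv.Perm Q} (hk : ∀ u v, k (u * v) = k u * k v) (u : Q) :
    k * RR u = RR (k u) * k := by
  ext v; exact hk v u

theorem LL_nuc (u : Q) {m : Q} (h : m ∈ nucleus Q) : LL (u * m) = LL u * LL m := by
  ext v; exact (h.2.1 u v).symm
theorem RR_nuc (u : Q) {m : Q} (h : m ∈ nucleus Q) : RR (u * m) = RR m * RR u := by
  ext v; exact (h.2.2 v u)

theorem FF_nucl (x v : Q) {m : Q} (h : m ∈ nucleus Q) : FF (x * m) v = FF x v := by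
  have e := nuc_commR h _ (RR_mem v)
  have e2 : RR v = LL m * RR v * (LL m)⁻¹ := by rw [e]; group
  rw [FF, LL_nuc x h]
  conv_rhs => rw [FF, e2]
  have : LL m * RR v * (LL m)⁻¹ = RR v := e2.symm
  calc LL x * LL m * RR v * (LL x * LL m)⁻¹ * (RR v)⁻¹
      = LL x * (LL m * RR v * (LL m)⁻¹) * (LL x)⁻¹ * (RR v)⁻¹ := by group
    _ = _ := by rw [this]
theorem FF_nucr (hcc : IsCC Q) (x v : Q) {m : Q} (h : m ∈ nucleus Q) : FF x (v * m) = FF x v := by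
  have e := nuc_commL h _ (LL_mem x)
  have e3 := nuc_commL h
  have : LL x * RR m = RR m * LL x := e.symm
  have e4 : RR m * FF x v * (RR m)⁻¹ = FF x (v * m) := by
    rw [FF, FF, RR_nuc v h]
    calc RR m * (LL x * RR v * (LL x)⁻¹ * (RR v)⁻¹) * (RR m)⁻¹
       = (RR m * LL x) * RR v * (LL x)⁻¹ * (RR v)⁻¹ * (RR m)⁻¹ := by group
     _ = _ := by rw [e]; group
  rw [← e4, e3 _ (FF_mem_L hcc x v)]; group


theorem DD_FF (hcc : IsCC Q) {S : Equiv.Perm Q} (h : S ∈ DD Q) (y w : Q) :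
    S * FF y w = FF y w * S := by
  obtain ⟨c, hc, k, rfl, hk, hm⟩ := DD_dec hcc h
  have e1 : k * FF y w = FF (k y) (k w) * k := by
    have a1 : k * LL y * k⁻¹ = LL (k y) := by rw [aut_L hk]; group
    have a2 : k * RR w * k⁻¹ = RR (k w) := by rw [aut_R hk]; group
    rw [FF, FF, ← a1, ← a2]; group
  have e2 : FF (k y) (k w) = FF y w := by
    obtain ⟨m, h1, e⟩ := hm y
    obtain ⟨m', h1', e'⟩ := hm w
    rw [e, e', FF_nucl _ _ h1, FF_nucr hcc _ _ h1']
  rw [mul_assoc, e1, e2, ← mul_assoc, nuc_commL hc _ (FF_mem_L hcc y w), mul_assoc]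

theorem DD_comm (hcc : IsCC Q) {S : Equiv.Perm Q} (h : S ∈ DD Q) (u v : Q) :
    RR v * (LL u * S * (LL u)⁻¹ * S⁻¹) = (LL u * S * (LL u)⁻¹ * S⁻¹) * RR v := by
  obtain ⟨c, hc, k, rfl, hk, hm⟩ := DD_dec hcc h
  obtain ⟨m, h1, e⟩ := hm u
  have a1 : k * LL u * k⁻¹ = LL u * LL m := by rw [aut_L hk, e, LL_nuc _ h1]; group
  have a2 : RR c * k * LL u * (RR c * k)⁻¹ = LL u * LL m := by
    calc RR c * k * LL u * (RR c * k)⁻¹ = RR c * (k * LL u * k⁻¹) * (RR c)⁻¹ := by group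
      _ = RR c * (LL u * LL m) * (RR c)⁻¹ := by rw [a1]
      _ = _ := by rw [nuc_commL hc _ (mul_mem (LL_mem u) (LL_mem m))]; group
  have a3 : LL u * (RR c * k) * (LL u)⁻¹ * (RR c * k)⁻¹ = LL u * (LL m)⁻¹ * (LL u)⁻¹ := by
    have : LL u * (RR c * k) * (LL u)⁻¹ * (RR c * k)⁻¹ =
      LL u * (RR c * k * LL u * (RR c * k)⁻¹)⁻¹ := by group
    rw [this, a2]; group
  rw [a3]
  have a4 := nuc_commR h1 _ (nRL' hcc u _ (RR_mem v))
  rw [inv_inv] at a4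
  have a5 : (LL m)⁻¹ * ((LL u)⁻¹ * RR v * LL u) = ((LL u)⁻¹ * RR v * LL u) * (LL m)⁻¹ := by
    rw [inv_mul_eq_iff_eq_mul, ← mul_assoc, a4]; group
  calc RR v * (LL u * (LL m)⁻¹ * (LL u)⁻¹)
     = LL u * (((LL u)⁻¹ * RR v * LL u) * (LL m)⁻¹) * (LL u)⁻¹ := by group
   _ = _ := by rw [← a5]; group

def MM (Q : Type*) [Loop Q] : Subgroup (Equiv.Perm Q) :=
  DD Q ⊓ Subgroup.centralizer (DD Q : Set (Equiv.Perm Q))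

theorem mem_MM {m : Equiv.Perm Q} : m ∈ MM Q ↔ m ∈ DD Q ∧ ∀ S ∈ DD Q, S * m = m * S := by
  rw [MM, Subgroup.mem_inf, Subgroup.mem_centralizer_iff]
  rfl

theorem FF_MM (hcc : IsCC Q) (x v : Q) : FF x v ∈ MM Q :=
  mem_MM.2 ⟨FF_mem hcc x v, fun _ hS => DD_FF hcc hS x v⟩

theorem MM_conj (g : Equiv.Perm Q) (h1 : ∀ a ∈ DD Q, g * a * g⁻¹ ∈ DD Q)
    (h2 : ∀ a ∈ DD Q, g⁻¹ * a * g ∈ DD Q) {m : Equiv.Perm Q} (hm : m ∈ MM Q) :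
    g * m * g⁻¹ ∈ MM Q := by
  rw [mem_MM] at *
  refine ⟨h1 _ hm.1, fun S hS => ?_⟩
  have := hm.2 _ (h2 S hS)
  calc S * (g * m * g⁻¹) = g * (g⁻¹ * S * g * m) * g⁻¹ := by group
    _ = _ := by rw [this]; group

/-- conjugation on the abelian group -/
def cj (g : Equiv.Perm Q) (h : ∀ m ∈ MM Q, g * m * g⁻¹ ∈ MM Q) :
    Additive (MM Q) →+ Additive (MM Q) where
  toFun m := Additive.ofMul ⟨g * (m.toMul : Equiv.Perm Q) * g⁻¹, h _ m.toMul.2⟩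
  map_zero' := by
    apply Additive.toMul.injective
    apply Subtype.ext
    simp
  map_add' a b := by
    apply Additive.toMul.injective
    apply Subtype.ext
    simp

@[reducible] def MMcg (Q : Type*) [Loop Q] : CommGroup (MM Q) :=
  { (inferInstance : Group (MM Q)) with
    mul_comm := fun a b => Subtype.ext ((mem_MM.1 b.2).2 _ (mem_MM.1 a.2).1) }

theorem comm_nuc (hcc : IsCC Q) (x y c : Q) (hc : (x * y) * c = y * x) : c ∈ nucleus Q := by
  letI := MMcg Q
  have hL : ∀ y : Q, ∀ m ∈ MM Q, LL y * m * (LL y)⁻¹ ∈ MM Q := fun y m hm =>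
    MM_conj _ (fun a ha => DD_L hcc y ha) (fun a ha => DD_L' hcc y ha) hm
  have hR : ∀ y : Q, ∀ m ∈ MM Q, RR y * m * (RR y)⁻¹ ∈ MM Q := fun y m hm =>
    MM_conj _ (fun a ha => DD_R hcc y ha) (fun a ha => DD_R' hcc y ha) hm
  let lam : Q → Additive (MM Q) →+ Additive (MM Q) := fun y => cj (LL y) (hL y)
  let rho : Q → Additive (MM Q) →+ Additive (MM Q) := fun y => cj (RR y) (hR y)
  let F : Q → Q → Additive (MM Q) := fun x v => Additive.ofMul ⟨FF x v, FF_MM hcc x v⟩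
  let val : Additive (MM Q) → Equiv.Perm Q := fun m => (m.toMul : Equiv.Perm Q)
  have vinj : ∀ a b, val a = val b → a = b := fun a b h =>
    Additive.toMul.injective (Subtype.ext h)
  have vadd : ∀ a b, val (a + b) = val a * val b := fun a b => rfl
  have vsub : ∀ a b, val (a - b) = val a * (val b)⁻¹ := fun a b => by
    rw [sub_eq_add_neg]; rfl
  have vlam : ∀ y a, val (lam y a) = LL y * val a * (LL y)⁻¹ := fun y a => rfl
  have vrho : ∀ y a, val (rho y a) = RR y * val a * (RR y)⁻¹ := fun y a => rfl
  have vF : ∀ x v, val (F x v) = FF x v := fun x v => rfl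
  have hI : ∀ x y v, F (x * y) v = lam x (F y v) + F x v - F x y + rho v (F x y) := by
    intro x y v
    have : F x y + F (x * y) v - rho v (F x y) = lam x (F y v) + F x v := by
      apply vinj
      simp only [vadd, vsub, vlam, vrho, vF]
      have : LL (x * y) = (FF x y)⁻¹ * (LL x * LL y) := by rw [FF_L hcc]; group
      rw [FF.eq_1 (x * y), this, FF.eq_1 y v, FF.eq_1 x v]; group
    rw [← sub_eq_zero] at this ⊢
    rw [← this]; abel
  have hII : ∀ x y v, F x (y * v) = lam x (F y v) - F y v + F x v + rho v (F x y) := by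
    intro x y v
    have : F x (y * v) + F y v = lam x (F y v) + F x v + rho v (F x y) := by
      apply vinj
      simp only [vadd, vsub, vlam, vrho, vF]
      rw [FF.eq_1 x (y * v), FF_R hcc y v, FF.eq_1 x v, FF.eq_1 x y]; group
    rw [← sub_eq_zero] at this ⊢
    rw [← this]; abel
  have hIII : ∀ x y, ∃ x', F y x = F x' y ∧
      ∀ v, lam y (F x v) = lam x' (F y v) - F y v + F x' v := by
    intro x y
    refine ⟨rd (y * x) y, ?_, ?_⟩
    · apply vinj
      rw [vF, vF]
      have h1 := FF_L hcc y x
      have h2 := FF_L hcc (rd (y * x) y) y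
      rw [rd_mul, ← conjL hcc] at h2
      have h3 : LL y * LL x * (LL y)⁻¹ * LL y = LL y * LL x := by group
      rw [h3, h1] at h2
      exact mul_right_cancel h2
    · intro v
      have : lam y (F x v) + F y v = lam (rd (y * x) y) (F y v) + F (rd (y * x) y) v := by
        apply vinj
        simp only [vadd, vsub, vlam, vrho, vF]
        rw [FF.eq_1 (rd (y * x) y), ← conjL hcc, FF.eq_1 x v, FF.eq_1 y v]; group
      rw [← sub_eq_zero] at this ⊢
      rw [← this]; abel
  have hIII' : ∀ x y, ∃ x', F x y = F y x' ∧
      ∀ v, rho y (F v x) = rho x' (F v y) - F v y + F v x' := by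
    intro x y
    refine ⟨ld y (x * y), ?_, ?_⟩
    · apply vinj
      rw [vF, vF]
      have h1 := FF_R hcc x y
      have h2 := FF_R hcc y (ld y (x * y))
      rw [mul_ld, ← conjR hcc, h1] at h2
      have h3 : FF y (ld y (x * y)) * (RR y * RR x * (RR y)⁻¹) * RR y =
        FF y (ld y (x * y)) * RR y * RR x := by group
      rw [h3] at h2
      exact mul_right_cancel (mul_right_cancel h2)
    · intro v
      have : rho y (F v x) + F v y = F v (ld y (x * y)) + rho (ld y (x * y)) (F v y) := by
        rw [add_comm (rho y (F v x))]
        apply vinj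
        simp only [vadd, vsub, vlam, vrho, vF]
        rw [FF.eq_1 v (ld y (x * y)), ← conjR hcc, FF.eq_1 v x, FF.eq_1 v y]; group
      rw [← sub_eq_zero] at this ⊢
      rw [← this]; abel
  have hV' : ∀ y v m, rho v (lam y m - m) = lam y m - m := by
    intro y v m
    apply vinj
    simp only [vsub, vlam, vrho]
    rw [DD_comm hcc (mem_MM.1 m.toMul.2).1]
    group
    rfl
  have hcomm : ∀ y v m, lam y (rho v m) = rho v (lam y m) := by
    intro y v m
    apply vinj
    simp only [vlam, vrho]
    have h1 : LL y * RR v = FF y v * RR v * LL y := by rw [FF]; group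
    have h2 := (mem_MM.1 (rho v (lam y m)).toMul.2).2 _ (FF_mem hcc y v)
    change FF y v * (RR v * (LL y * val m * (LL y)⁻¹) * (RR v)⁻¹) =
      (RR v * (LL y * val m * (LL y)⁻¹) * (RR v)⁻¹) * FF y v at h2
    calc LL y * (RR v * val m * (RR v)⁻¹) * (LL y)⁻¹
        = (LL y * RR v) * val m * (LL y * RR v)⁻¹ := by group
      _ = FF y v * (RR v * (LL y * val m * (LL y)⁻¹) * (RR v)⁻¹) * (FF y v)⁻¹ := by
        rw [h1]; group
      _ = _ := by rw [h2]; group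
  have hV : ∀ y v m, lam y (rho v m - m) = rho v m - m := by
    intro y v m
    have h1 := hV' y v m
    rw [map_sub, ← hcomm] at h1
    rw [map_sub]
    rw [← sub_eq_zero] at h1 ⊢
    rw [← h1]; abel
  have linj : ∀ w a b, lam w a = lam w b → a = b := by
    intro w a b h
    have := congrArg val h
    simp only [vlam] at this
    exact vinj _ _ (mul_left_cancel (mul_right_cancel this))
  obtain ⟨B1, B2⟩ := abs_key (fun x y : Q => y * x) rho lam (fun x v => -F v x)
    (by
      intro x y v
      have h := hII v y x
      simp only [map_neg]
      rw [h]; abel)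
    (by
      intro x y v
      have h := hI v y x
      simp only [map_neg]
      rw [h]; abel)
    (by
      intro x y
      obtain ⟨x', h1, h2⟩ := hIII' x y
      refine ⟨x', by rw [h1], fun v => ?_⟩
      simp only [map_neg]
      rw [h2]; abel)
    (by
      intro y v x z
      have h := hV' v y (F z x)
      rw [map_sub] at h
      simp only [map_neg, map_sub]
      rw [← sub_eq_zero] at h ⊢
      rw [← neg_eq_zero, ← h]; abel)
    (by
      intro y v x z
      have h := hV v y (F z x)
      rw [map_sub] at h
      simp only [map_neg, map_sub]
      rw [← sub_eq_zero] at h ⊢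
      rw [← neg_eq_zero, ← h]; abel)
    linj
  have symmR : ∀ w v, lam w (F c v) = F c v := by
    intro w v
    have h1 := B2 y x c hc v w
    have h2 := B1 c v w
    rw [h1, sub_self] at h2
    have h3 := sub_eq_zero.1 h2.symm
    rw [map_neg] at h3
    exact neg_injective h3
  apply nuc_of_FF hcc
  intro v
  have hcL : ∀ u, LL u * FF c v = FF c v * LL u := by
    intro u
    have := congrArg val (symmR u v)
    rw [vlam, vF] at this
    exact mul_inv_eq_iff_eq_mul.1 this
  have h1 : ∀ u, FF c v u = u * FF c v 1 := by
    intro u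
    have := congrArg (fun e : Equiv.Perm Q => e 1) (hcL u)
    simp only [Equiv.Perm.mul_apply, LL_apply, Loop.mul_one] at this
    exact this.symm
  have h2 : FF c v (c * v) = c * v := by
    have := congrArg (fun e : Equiv.Perm Q => e 1) (FF_L hcc c v)
    simp only [Equiv.Perm.mul_apply, LL_apply, Loop.mul_one] at this
    exact this.symm
  have h3 : FF c v 1 = 1 := by
    rw [h1] at h2
    have := congrArg (ld (c * v)) h2
    rw [ld_mul] at this
    rw [this]
    have h4 := ld_mul (c * v) 1
    rwa [Loop.mul_one] at h4
  ext u
  rw [h1, h3, Loop.mul_one]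
  rfl

end
end Loop

/-- (Basarab) In a CC-loop, all associators and commutators lie in the nucleus
(so `Q/N(Q)` is an abelian group). -/
theorem stmt_0 {Q : Type*} [Loop Q] (hcc : IsCC Q) (x y z : Q) :
    ld (x * (y * z)) ((x * y) * z) ∈ nucleus Q ∧ ld (x * y) (y * x) ∈ nucleus Q := by
  refine ⟨?_, comm_nuc hcc x y _ (mul_ld _ _)⟩
  have h1 : FF x y ((x * y) * z) = x * (y * z) :=
    (congrArg (fun e : Equiv.Perm Q => e z) (FF_L hcc x y)).symm
  have h2 := DD_one hcc (DD_L' hcc (x * (y * z)) (inv_mem (FF_mem hcc x y)))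
  have h3 : ((LL (x * (y * z)))⁻¹ * (FF x y)⁻¹ * LL (x * (y * z))) 1 =
      ld (x * (y * z)) ((x * y) * z) := by
    rw [Equiv.Perm.mul_apply, Equiv.Perm.mul_apply, LL_apply, Loop.mul_one,
      Equiv.Perm.inv_eq_iff_eq.2 h1.symm]
    rfl
  rw [h3] at h2
  exact h2
end

section
/- In a CC-loop, the associators (x,y,z) and [x,y,z] are invariant under all permutations of the set {x,y,z}; in particular, for all x, y, z: (x,y,z) = (y,x,z) and (x,y,z) = (x,z,y), and likewise [x,y,z] = [y,x,z] and [x,y,z] = [x,z,y]. -/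
open Loop

section aux
variable {Q : Type*} [Loop Q]

def Lp (x : Q) : Equiv.Perm Q := ⟨fun y => x * y, fun y => ld x y, fun y => Loop.ld_mul x y, fun y => Loop.mul_ld x y⟩
def Rp (x : Q) : Equiv.Perm Q := ⟨fun y => y * x, fun y => rd y x, fun y => Loop.mul_rd y x, fun y => Loop.rd_mul y x⟩

theorem Lp_apply (x y : Q) : Lp x y = x * y := rfl
theorem Rp_apply (x y : Q) : Rp x y = y * x := rfl

theorem pp_self (f : Equiv.Perm Q) (x : Q) : f (f⁻¹ x) = x := f.apply_symm_apply x
theorem pi_self (f : Equiv.Perm Q) (x : Q) : f⁻¹ (f x) = x := f.symm_apply_apply x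

def Atp (A B C : Equiv.Perm Q) : Prop := ∀ z w : Q, A z * B w = C (z * w)

theorem Atp.mul {A B C A' B' C' : Equiv.Perm Q} (h : Atp A B C) (h' : Atp A' B' C') :
    Atp (A * A') (B * B') (C * C') := by
  intro z w
  simp only [Equiv.Perm.mul_apply]
  rw [h, h']

theorem Atp.inv {A B C : Equiv.Perm Q} (h : Atp A B C) : Atp A⁻¹ B⁻¹ C⁻¹ := by
  intro z w
  rw [Equiv.Perm.eq_inv_iff_eq, ← h]
  simp

theorem lcancel {x y z : Q} (h : x * y = x * z) : y = z := (Lp x).injective h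
theorem rcancel {x y z : Q} (h : y * x = z * x) : y = z := (Rp x).injective h

theorem atp_alpha (hcc : IsCC Q) (x : Q) : Atp ((Rp x)⁻¹ * Lp x) (Lp x) (Lp x) := by
  intro z w
  exact (hcc.1 x z w).symm

theorem atp_beta (hcc : IsCC Q) (x : Q) : Atp (Rp x) ((Lp x)⁻¹ * Rp x) (Rp x) := by
  intro z w
  exact (hcc.2 x w z).symm

theorem L_R (hcc : IsCC Q) (x w : Q) : Lp x * Rp w = Rp (x * w) * ((Rp x)⁻¹ * Lp x) := by
  ext z
  exact hcc.1 x z w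

theorem R_L (hcc : IsCC Q) (x z : Q) : Rp x * Lp z = Lp (z * x) * ((Lp x)⁻¹ * Rp x) := by
  ext w
  exact hcc.2 x w z

structure Nuc (a : Q) : Prop where
  l : ∀ x y : Q, a * (x * y) = (a * x) * y
  m : ∀ x y : Q, x * (a * y) = (x * a) * y
  r : ∀ x y : Q, x * (y * a) = (x * y) * a

theorem nuc_of_r (hcc : IsCC Q) {a : Q} (h : ∀ x y : Q, x * (y * a) = (x * y) * a) : Nuc a := by
  have hm : ∀ x y : Q, x * (a * y) = (x * a) * y := by
    intro x y
    have h1 := DFunLike.congr_fun (R_L hcc a x) (((Lp a)⁻¹ * Rp a)⁻¹ y)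
    have h2 : ∀ t, Rp a (Lp x t) = Lp x (Rp a t) := fun t => (h x t).symm
    simp only [Equiv.Perm.mul_apply] at h1
    rw [h2] at h1
    simp only [mul_inv_rev, inv_inv, Equiv.Perm.mul_apply, pp_self, pi_self] at h1
    exact h1
  refine ⟨?_, hm, h⟩
  intro x y
  have h1 := DFunLike.congr_fun (L_R hcc a y) x
  have h2 : ∀ t, Rp (a * y) t = Rp y (Rp a t) := fun t => hm t y
  simp only [Equiv.Perm.mul_apply] at h1
  rw [h2] at h1
  simp only [pp_self] at h1
  exact h1

theorem comm_r (hcc : IsCC Q) (x q : Q) :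
    ∃ m : Q, Nuc m ∧ ∀ z : Q, (z * x) * q = ((z * q) * x) * m := by
  obtain ⟨w, rfl⟩ : ∃ w, q = x * w := ⟨ld x q, (Loop.mul_ld x q).symm⟩
  have a := atp_alpha hcc x
  have bx := atp_beta hcc x
  have bw := atp_beta hcc w
  have bq := atp_beta hcc (x * w)
  have LR := L_R hcc x w
  have g := (bx.mul ((((a.mul bw).mul a.inv).mul bq.inv).mul bx).inv).mul bx.inv
  have hw : Rp w = (Lp x)⁻¹ * (Rp (x * w) * ((Rp x)⁻¹ * Lp x)) := by rw [← LR]; group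
  set B := ((Lp x)⁻¹ * Rp x) * (Lp x * ((Lp w)⁻¹ * Rp w) * (Lp x)⁻¹ * ((Lp (x * w))⁻¹ * Rp (x * w))⁻¹ * ((Lp x)⁻¹ * Rp x))⁻¹ * ((Lp x)⁻¹ * Rp x)⁻¹ with hB
  clear_value B
  have g2 : Atp 1 B (Rp (x * w) * Rp x * (Rp (x * w))⁻¹ * (Rp x)⁻¹) := by
    convert g using 1
    · rw [hw]; group
    · rw [hw]; group
  set D := Rp (x * w) * Rp x * (Rp (x * w))⁻¹ * (Rp x)⁻¹ with hD
  have hBD : ∀ t, B t = D t := by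
    intro t
    have := g2 1 t
    simpa [Loop.one_mul] using this
  have hD1 : ∀ z t, z * D t = D (z * t) := by
    intro z t
    have := g2 z t
    rw [hBD] at this
    exact this
  have hD2 : ∀ z, D z = z * D 1 := by
    intro z
    rw [hD1, Loop.mul_one]
  refine ⟨D 1, nuc_of_r hcc ?_, ?_⟩
  · intro s t
    rw [← hD2, ← hD2, hD1]
  · intro z
    rw [← hD2]
    have : D * (Rp x * Rp (x * w)) = Rp (x * w) * Rp x := by rw [hD]; group
    exact (DFunLike.congr_fun this z).symm

/-- conjugating past nuclear elements -/
theorem nuc_conj (hcc : IsCC Q) {n : Q} (hn : Nuc n) (x : Q) : ∃ m, Nuc m ∧ n * x = x * m := by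
  obtain ⟨m, hm, h⟩ := comm_r hcc n x
  have h1 := h 1
  simp only [Loop.one_mul] at h1
  refine ⟨n * m, nuc_of_r hcc ?_, ?_⟩
  · intro s t
    rw [hm.r, hm.r, hm.r, hn.r]
  · rw [h1, hm.r]

theorem nuc_conj' (hcc : IsCC Q) {n : Q} (hn : Nuc n) (x : Q) : ∃ m, Nuc m ∧ x * n = m * x := by
  have key : Nuc (rd (x * n) x) := by
    have a := atp_alpha hcc x
    have t : Atp (Lp n) 1 (Lp n) := fun z w => (hn.l z w).symm
    have g := (a.mul t).mul a.inv
    set A := (Rp x)⁻¹ * Lp x * Lp n * ((Rp x)⁻¹ * Lp x)⁻¹ with hA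
    set C := Lp x * Lp n * (Lp x)⁻¹ with hC
    have gg : ∀ z w, A z * w = C (z * w) := by
      intro z w
      have := g z w
      simpa using this
    have e1 : ∀ z, A z = C z := by
      intro z
      have := gg z 1
      simpa [Loop.mul_one] using this
    have e2 : ∀ w, C w = C 1 * w := by
      intro w
      have := gg 1 w
      rw [e1, Loop.one_mul] at this
      exact this.symm
    have e3 : C 1 = rd (x * n) x := by
      have : C x = x * n := by
        change x * (n * ld x x) = x * n
        have h1 := Loop.ld_mul x 1
        rw [Loop.mul_one] at h1
        rw [h1, Loop.mul_one]
      rw [e2] at this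
      rw [← this, Loop.mul_rd]
    have hl : ∀ s t, rd (x * n) x * (s * t) = (rd (x * n) x * s) * t := by
      intro s t
      rw [← e3, ← e2, ← e2, ← gg, e1]
    -- left nuclear implies right nuclear
    generalize rd (x * n) x = k at hl
    have hm : ∀ s t : Q, s * (k * t) = (s * k) * t := by
      intro s t
      obtain ⟨u, rfl⟩ : ∃ u, s = ((Rp k)⁻¹ * Lp k) u :=
        ⟨((Rp k)⁻¹ * Lp k)⁻¹ s, by simp⟩
      have h1 := hcc.1 k u t
      have h2 : ((Rp k)⁻¹ * Lp k) u = rd (k * u) k := rfl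
      rw [h2, ← h1, Loop.rd_mul, hl]
    apply nuc_of_r hcc
    intro s t
    rw [hcc.2 k t s, ← hm, Loop.mul_ld]
  exact ⟨_, key, (Loop.rd_mul _ _).symm⟩

theorem comm_l (hcc : IsCC Q) (x q : Q) :
    ∃ n : Q, Nuc n ∧ x * q = n * (q * x) ∧ ∀ z : Q, x * (q * z) = n * (q * (x * z)) := by
  obtain ⟨m, hm, h⟩ := comm_r hcc x q
  have h1 := h 1
  simp only [Loop.one_mul] at h1
  obtain ⟨n, hn, h2⟩ := nuc_conj' hcc hm (q * x)
  rw [h2] at h1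
  refine ⟨n, hn, h1, ?_⟩
  intro z
  rw [hcc.1, h1, hn.l, Loop.mul_rd, ← hn.l]

theorem lassoc_iff (x y z a : Q) :
    ld (x * (y * z)) ((x * y) * z) = a ↔ (x * y) * z = (x * (y * z)) * a := by
  constructor
  · rintro rfl
    rw [Loop.mul_ld]
  · intro h
    rw [h, Loop.ld_mul]

theorem rassoc_iff (x y z a : Q) :
    rd (x * (y * z)) ((x * y) * z) = a ↔ x * (y * z) = a * ((x * y) * z) := by
  constructor
  · rintro rfl
    rw [Loop.rd_mul]
  · intro h
    rw [h, Loop.mul_rd]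

/-- `(x,y,z)` is symmetric in the first two. -/
theorem la12 (hcc : IsCC Q) {x y z a : Q} (h : (x * y) * z = (x * (y * z)) * a) :
    (y * x) * z = (y * (x * z)) * a := by
  obtain ⟨n, hn, h1, h2⟩ := comm_l hcc x y
  rw [h1, h2, ← hn.l, ← hn.l] at h
  exact lcancel h

theorem ra23 (hcc : IsCC Q) {x y z a : Q} (h : x * (y * z) = a * ((x * y) * z)) :
    x * (z * y) = a * ((x * z) * y) := by
  obtain ⟨m, hm, h1⟩ := comm_r hcc y z
  have h2 := h1 1
  simp only [Loop.one_mul] at h2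
  rw [h1, h2, hm.r, hm.r] at h
  exact rcancel h

theorem la_comm (hcc : IsCC Q) {x y z a n : Q} (h : (x * y) * z = (x * (y * z)) * a)
    (hn : Nuc n) : a * n = n * a := by
  obtain ⟨n', hn', e⟩ := nuc_conj' hcc hn z
  obtain ⟨n2, hn2, e2⟩ := nuc_conj' hcc hn' y
  -- (x, n2 y, z) = a
  have h3 : ((n2 * y) * x) * z = ((n2 * y) * (x * z)) * a := by
    rw [← hn2.l, ← hn2.l, ← hn2.l, ← hn2.l, la12 hcc h]
  have h4 := la12 hcc h3
  have e3 : x * ((n2 * y) * z) = (x * (y * z)) * n := by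
    rw [← e2, ← hn'.m, ← e, hn.r, hn.r]
  have e4 : (x * (n2 * y)) * z = ((x * y) * z) * n := by
    rw [← e2, hn'.r, ← hn'.m, ← e, hn.r]
  rw [e3, e4, h, ← hn.r, ← hn.m] at h4
  exact lcancel h4

theorem ra_comm (hcc : IsCC Q) {x y z a n : Q} (h : x * (y * z) = a * ((x * y) * z))
    (hn : Nuc n) : a * n = n * a := by
  obtain ⟨n', hn', e⟩ := nuc_conj hcc hn x
  obtain ⟨n2, hn2, e2⟩ := nuc_conj hcc hn' y
  have h3 : x * (z * (y * n2)) = a * ((x * z) * (y * n2)) := by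
    rw [hn2.r, hn2.r, hn2.r, hn2.r, ra23 hcc h]
  have h4 := ra23 hcc h3
  have e3 : x * ((y * n2) * z) = n * (x * (y * z)) := by
    rw [← e2, ← hn'.l, hn'.m, ← e, hn.l]
  have e4 : (x * (y * n2)) * z = n * ((x * y) * z) := by
    rw [← e2, hn'.m, ← e, hn.l, hn.l]
  rw [e3, e4, h, hn.l, hn.m] at h4
  exact (rcancel h4).symm

theorem la23 (hcc : IsCC Q) {x y z a : Q} (h : (x * y) * z = (x * (y * z)) * a) :
    (x * z) * y = (x * (z * y)) * a := by
  obtain ⟨m, hm, h1⟩ := comm_r hcc z y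
  have h2 := h1 1
  simp only [Loop.one_mul] at h2
  have hc := la_comm hcc h hm
  rw [h1, h2, h, hm.r, ← hm.r, hc, hm.m]

theorem ra12 (hcc : IsCC Q) {x y z a : Q} (h : x * (y * z) = a * ((x * y) * z)) :
    y * (x * z) = a * ((y * x) * z) := by
  obtain ⟨n, hn, h1, h2⟩ := comm_l hcc y x
  have hc := ra_comm hcc h hn
  rw [h1, h2, h, ← hn.l, hn.l, ← hc, hn.m]

end aux

/-- In a CC-loop, the associators `(x,y,z)` and `[x,y,z]` are invariant under
all permutations of `{x,y,z}`. -/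
theorem stmt_5 {Q : Type*} [Loop Q] (hcc : IsCC Q) (x y z : Q) :
    ld (x * (y * z)) ((x * y) * z) = ld (y * (x * z)) ((y * x) * z) ∧
    ld (x * (y * z)) ((x * y) * z) = ld (x * (z * y)) ((x * z) * y) ∧
    rd (x * (y * z)) ((x * y) * z) = rd (y * (x * z)) ((y * x) * z) ∧
    rd (x * (y * z)) ((x * y) * z) = rd (x * (z * y)) ((x * z) * y) := by
  refine ⟨?_, ?_, ?_, ?_⟩
  · exact ((lassoc_iff _ _ _ _).2 (la12 hcc ((lassoc_iff _ _ _ _).1 rfl))).symm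
  · exact ((lassoc_iff _ _ _ _).2 (la23 hcc ((lassoc_iff _ _ _ _).1 rfl))).symm
  · exact ((rassoc_iff _ _ _ _).2 (ra12 hcc ((rassoc_iff _ _ _ _).1 rfl))).symm
  · exact ((rassoc_iff _ _ _ _).2 (ra23 hcc ((rassoc_iff _ _ _ _).1 rfl))).symm
end

section
/- In a CC-loop Q, every associator (x,y,z) lies in the nucleus N(Q) and commutes with every element of N(Q): for all x, y, z ∈ Q and all a ∈ N(Q), (x,y,z) ∈ N(Q) and (x,y,z)·a = a·(x,y,z). Hence if Q is nonassociative, the nucleus of Q has a nontrivial center containing all associators. -/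
open Loop

namespace CCproof

theorem app_inv {X : Type*} (f : Equiv.Perm X) (x : X) : f (f⁻¹ x) = x := Equiv.apply_symm_apply f x
theorem inv_app {X : Type*} (f : Equiv.Perm X) (x : X) : f⁻¹ (f x) = x := Equiv.symm_apply_apply f x

variable {Q : Type*} [Loop Q]

def L (x : Q) : Equiv.Perm Q := ⟨fun y => x * y, fun y => ld x y, fun y => Loop.ld_mul x y, fun y => Loop.mul_ld x y⟩
def R (x : Q) : Equiv.Perm Q := ⟨fun y => y * x, fun y => rd y x, fun y => Loop.mul_rd y x, fun y => Loop.rd_mul y x⟩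

theorem L_app (x y : Q) : L x y = x * y := rfl
theorem R_app (x y : Q) : R x y = y * x := rfl
theorem Li_app (x y : Q) : (L x)⁻¹ y = ld x y := rfl
theorem Ri_app (x y : Q) : (R x)⁻¹ y = rd y x := rfl

def T (x : Q) : Equiv.Perm Q := (L x)⁻¹ * R x

theorem lc {x y z : Q} (h : x * y = x * z) : y = z := (L x).injective h
theorem rc {x y z : Q} (h : y * x = z * x) : y = z := (R x).injective h

theorem T_one (x : Q) : T x 1 = 1 := by
  apply lc (x := x)
  show x * ld x (1 * x) = x * 1
  rw [Loop.mul_ld, Loop.one_mul, Loop.mul_one]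

theorem Ti_one (x : Q) : (T x)⁻¹ 1 = 1 := by
  rw [Equiv.Perm.inv_eq_iff_eq, T_one]

def Atp (α β γ : Equiv.Perm Q) : Prop := ∀ y z, α y * β z = γ (y * z)

theorem Atp.mul {α β γ α' β' γ' : Equiv.Perm Q} (h : Atp α β γ) (h' : Atp α' β' γ') :
    Atp (α * α') (β * β') (γ * γ') := by
  intro y z
  simp only [Equiv.Perm.mul_apply]
  rw [h, h']

theorem Atp.inv {α β γ : Equiv.Perm Q} (h : Atp α β γ) : Atp α⁻¹ β⁻¹ γ⁻¹ := by
  intro y z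
  symm
  rw [Equiv.Perm.inv_eq_iff_eq, ← h]
  simp

def Mid (k : Q) : Prop := ∀ u w : Q, u * (k * w) = (u * k) * w

theorem mid_of_atp {α β : Equiv.Perm Q} (h : Atp α β 1) :
    Mid (β 1) ∧ ∀ w, β w = β 1 * w := by
  have h' : ∀ y z, α y * β z = y * z := h
  have h1 : ∀ u v, u * β v = (u * β 1) * v := by
    intro u v
    have e := h' (α⁻¹ u) v
    have e1 := h' (α⁻¹ u) 1
    simp only [app_inv] at e e1
    rw [Loop.mul_one] at e1
    rw [e, e1]
  have h2 : ∀ w, β w = β 1 * w := by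
    intro w
    have := h1 1 w
    rwa [Loop.one_mul, Loop.one_mul] at this
  refine ⟨fun u w => ?_, h2⟩
  rw [← h2, h1]

variable (hcc : IsCC Q)
include hcc

theorem A (x : Q) : Atp (T x)⁻¹ (L x) (L x) := by
  intro y z
  have : (T x)⁻¹ y = rd (x * y) x := by
    simp only [T, mul_inv_rev, inv_inv]; rfl
  rw [this]
  exact (hcc.1 x y z).symm

theorem B (x : Q) : Atp (R x) (T x) (R x) := by
  intro y z
  exact (hcc.2 x z y).symm

theorem mid_nuc {k : Q} (h : Mid k) : k ∈ nucleus Q := by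
  refine ⟨fun y z => ?_, h, fun y z => ?_⟩
  · -- left
    have e := hcc.1 k y z
    rw [e, h, Loop.rd_mul]
  · have e := hcc.2 k z y
    rw [e, ← h, Loop.mul_ld]

theorem LR (x y : Q) : L x * R y * (L x)⁻¹ = R (x * y) * (R x)⁻¹ := by
  rw [mul_inv_eq_iff_eq_mul]
  ext z
  exact hcc.1 x z y

theorem RL (x y : Q) : R y * L x * (R y)⁻¹ = L (x * y) * (L y)⁻¹ := by
  rw [mul_inv_eq_iff_eq_mul]
  ext z
  exact hcc.2 y z x

theorem LLR (x y : Q) : L x * L y * (L (x * y))⁻¹ = R (x * y) * (R x)⁻¹ * (R y)⁻¹ := by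
  rw [← LR hcc x y]
  have h : (R y * L x * (R y)⁻¹)⁻¹ = (L (x * y) * (L y)⁻¹)⁻¹ := by rw [RL hcc]
  simp only [mul_inv_rev, inv_inv] at h
  rw [mul_assoc, ← h]
  group

theorem T_coset (y u : Q) : ∃ k ∈ nucleus Q, T y u = u * k := by
  obtain ⟨x, hx⟩ : ∃ x, x * u = 1 := ⟨rd 1 u, Loop.rd_mul 1 u⟩
  have h := ((((A hcc x).mul (B hcc y)).mul (A hcc x).inv)).mul ((B hcc (x * y)).mul (B hcc x).inv).inv
  rw [LR hcc, mul_inv_cancel] at h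
  obtain ⟨hm, -⟩ := mid_of_atp h
  have hn := mid_nuc hcc hm
  refine ⟨_, hn, ?_⟩
  apply lc (x := x)
  rw [hn.2.2, hx, Loop.one_mul]
  have hu : (L x)⁻¹ 1 = u := by
    rw [Equiv.Perm.inv_eq_iff_eq]; exact hx.symm
  simp only [mul_inv_rev, inv_inv, Equiv.Perm.mul_apply, T_one, Ti_one, hu, L_app]

omit hcc in
theorem nuc_mul {a b : Q} (ha : a ∈ nucleus Q) (hb : b ∈ nucleus Q) : Mid (a * b) := by
  intro u w
  rw [← ha.1, ha.2.1, hb.2.1, hb.2.2]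

theorem nuc_inv {k : Q} (hk : k ∈ nucleus Q) :
    ∃ i ∈ nucleus Q, k * i = 1 ∧ i * k = 1 := by
  have h1 : k * ld k 1 = 1 := Loop.mul_ld k 1
  have h2 : ld k 1 * k = 1 := by
    apply lc (x := k)
    rw [hk.2.2, h1, Loop.one_mul, Loop.mul_one]
  refine ⟨ld k 1, mid_nuc hcc ?_, h1, h2⟩
  intro u w
  obtain ⟨v, rfl⟩ : ∃ v, w = k * v := ⟨ld k w, (Loop.mul_ld k w).symm⟩
  rw [hk.2.1 (ld k 1) v, h2, Loop.one_mul, hk.2.1, ← hk.2.2, h2, Loop.mul_one]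

theorem Ti_coset (y u : Q) : ∃ k ∈ nucleus Q, (T y)⁻¹ u = u * k := by
  obtain ⟨k, hk, e⟩ := T_coset hcc y ((T y)⁻¹ u)
  obtain ⟨i, hi, h1, -⟩ := nuc_inv hcc hk
  rw [app_inv] at e
  refine ⟨i, hi, ?_⟩
  conv_rhs => rw [e]
  rw [← hi.2.2, h1, Loop.mul_one]

omit hcc in
theorem T_swap (z a : Q) : a * z = z * T z a := (Loop.mul_ld z (a * z)).symm

theorem T_nuc (z : Q) {a : Q} (ha : a ∈ nucleus Q) : T z a ∈ nucleus Q := by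
  obtain ⟨k, hk, e⟩ := T_coset hcc z a
  rw [e]; exact mid_nuc hcc (nuc_mul ha hk)

theorem Ti_nuc (z : Q) {a : Q} (ha : a ∈ nucleus Q) : (T z)⁻¹ a ∈ nucleus Q := by
  obtain ⟨k, hk, e⟩ := Ti_coset hcc z a
  rw [e]; exact mid_nuc hcc (nuc_mul ha hk)

theorem assoc_coset (x y z : Q) : ∃ p ∈ nucleus Q, x * (y * z) = ((x * y) * z) * p := by
  have h := (((A hcc x).mul (A hcc y)).mul (A hcc (x * y)).inv).mul
    (((B hcc (x * y)).mul (B hcc x).inv).mul (B hcc y).inv).inv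
  rw [mul_inv_eq_one.mpr (LLR hcc x y)] at h
  obtain ⟨hm, hw⟩ := mid_of_atp h
  have hn := mid_nuc hcc hm
  revert hw hn
  generalize ((L x * L y * (L (x * y))⁻¹ * (T (x * y) * (T x)⁻¹ * (T y)⁻¹)⁻¹) 1) = n
  intro hw hn
  have e := hw ((T (x * y) * (T x)⁻¹ * (T y)⁻¹) ((x * y) * z))
  rw [Equiv.Perm.mul_apply _ (_)⁻¹, inv_app] at e
  simp only [Equiv.Perm.mul_apply, L_app, Li_app, Loop.ld_mul] at e
  rw [e]
  obtain ⟨k1, h1, e1⟩ := Ti_coset hcc y (x * y * z)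
  rw [e1]
  obtain ⟨k2, h2, e2⟩ := Ti_coset hcc x (x * y * z * k1)
  rw [e2]
  obtain ⟨k3, h3, e3⟩ := T_coset hcc (x * y) (x * y * z * k1 * k2)
  rw [e3, T_swap]
  have h4 := T_nuc hcc (x * y * z * k1 * k2 * k3) hn
  generalize T (x * y * z * k1 * k2 * k3) n = k4 at h4
  refine ⟨((k1 * k2) * k3) * k4, mid_nuc hcc (nuc_mul (mid_nuc hcc (nuc_mul (mid_nuc hcc (nuc_mul h1 h2)) h3)) h4), ?_⟩
  rw [h4.2.2, h3.2.2, h2.2.2]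

theorem ell_aut (x y u v : Q) :
    ((L (x * y))⁻¹ * L x * L y) (u * v) =
      ((L (x * y))⁻¹ * L x * L y) u * ((L (x * y))⁻¹ * L x * L y) v := by
  have h := ((A hcc (x * y)).inv.mul (A hcc x)).mul (A hcc y)
  have h1 : ((L (x * y))⁻¹ * L x * L y) 1 = 1 := by
    simp only [Equiv.Perm.mul_apply, L_app, Li_app, Loop.mul_one]
    apply lc (x := x * y)
    rw [Loop.mul_ld, Loop.mul_one]
  rw [← h u v]
  have := h u 1
  rw [h1, Loop.mul_one, Loop.mul_one] at this
  rw [this]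

omit hcc in
theorem ell_nuc (x y : Q) {a : Q} (ha : a ∈ nucleus Q) :
    ((L (x * y))⁻¹ * L x * L y) a = a := by
  simp only [Equiv.Perm.mul_apply, L_app, Li_app]
  rw [ha.2.2, Loop.ld_mul]

theorem comm_p (x y z p : Q) (hp : p ∈ nucleus Q) (e : x * (y * z) = ((x * y) * z) * p)
    {b : Q} (hb : b ∈ nucleus Q) : p * b = b * p := by
  have hz : ((L (x * y))⁻¹ * L x * L y) z = z * p := by
    simp only [Equiv.Perm.mul_apply, L_app, Li_app]
    rw [e, ← hp.2.2, Loop.ld_mul]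
  have ha := Ti_nuc hcc z hb
  have e1 := T_swap z ((T z)⁻¹ b)
  rw [app_inv] at e1
  have e2 := congrArg ((L (x * y))⁻¹ * L x * L y) e1
  rw [ell_aut hcc, ell_aut hcc, hz, ell_nuc x y ha, ell_nuc x y hb, hp.2.2, e1,
    ← hp.2.2, ← hp.2.1] at e2
  exact (lc e2).symm

end CCproof


/-- In a CC-loop, every associator lies in the nucleus and commutes with
every element of the nucleus. -/
theorem stmt_6 {Q : Type*} [Loop Q] (hcc : IsCC Q) (x y z : Q) :
    ld (x * (y * z)) ((x * y) * z) ∈ nucleus Q ∧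
    ∀ a ∈ nucleus Q,
      ld (x * (y * z)) ((x * y) * z) * a = a * ld (x * (y * z)) ((x * y) * z) := by
  obtain ⟨p, hp, e⟩ := CCproof.assoc_coset hcc x y z
  obtain ⟨i, hi, h1, h2⟩ := CCproof.nuc_inv hcc hp
  have hq : ld (x * (y * z)) ((x * y) * z) = i := by
    apply CCproof.lc (x := x * (y * z))
    rw [Loop.mul_ld, e, ← hp.2.1, h1, Loop.mul_one]
  rw [hq]
  refine ⟨hi, fun a ha => ?_⟩
  have c := CCproof.comm_p hcc x y z p hp e ha
  apply CCproof.lc (x := p)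
  rw [hp.1, h1, Loop.one_mul, hp.1, c, ← hp.2.1, h1, Loop.mul_one]
end

section
/- In an extra loop, for all x, y, z: the two associators coincide, (x,y,z) = [x,y,z]; every associator has order at most 2, (x,y,z)·(x,y,z) = 1; and each associator commutes with its arguments: (x,y,z)·x = x·(x,y,z), (x,y,z)·y = y·(x,y,z), and (x,y,z)·z = z·(x,y,z). -/
open Loop

/-- In an extra loop: `(x,y,z) = [x,y,z]`, every associator has order at most 2,
and each associator commutes with its arguments. -/
theorem stmt_9 {Q : Type*} [Loop Q]
    (hextra : ∀ x y z : Q, x * (y * (z * x)) = ((x * y) * z) * x) :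
    ∀ x y z : Q,
      ld (x * (y * z)) ((x * y) * z) = rd (x * (y * z)) ((x * y) * z) ∧
      ld (x * (y * z)) ((x * y) * z) * ld (x * (y * z)) ((x * y) * z) = 1 ∧
      ld (x * (y * z)) ((x * y) * z) * x = x * ld (x * (y * z)) ((x * y) * z) ∧
      ld (x * (y * z)) ((x * y) * z) * y = y * ld (x * (y * z)) ((x * y) * z) ∧
      ld (x * (y * z)) ((x * y) * z) * z = z * ld (x * (y * z)) ((x * y) * z) := by
  have om := Loop.one_mul (Q := Q)
  have mo := Loop.mul_one (Q := Q)
  have lc : ∀ a b c : Q, a * b = a * c → b = c := fun a b c h => by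
    rw [← Loop.ld_mul a b, h, Loop.ld_mul]
  have rc : ∀ a b c : Q, b * a = c * a → b = c := fun a b c h => by
    rw [← Loop.mul_rd b a, h, Loop.mul_rd]
  have flex : ∀ x z : Q, x * (z * x) = (x * z) * x := fun x z => by
    have := hextra x 1 z
    rwa [om, mo] at this
  obtain ⟨i, hi⟩ : ∃ i : Q → Q, ∀ x, x * i x = 1 := ⟨fun x => ld x 1, fun x => Loop.mul_ld x 1⟩
  have hl : ∀ x b : Q, x * (i x * b) = b := fun x b => by
    have := hextra x (i x) (rd b x)
    rw [Loop.rd_mul, hi, om, Loop.rd_mul] at this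
    exact this
  have hi2 : ∀ x : Q, i x * x = 1 := fun x => by
    apply lc x
    rw [hl, mo]
  have hl2 : ∀ x b : Q, i x * (x * b) = b := fun x b => lc x _ _ (hl x _)
  have hr2 : ∀ x c : Q, (c * i x) * x = c := fun x c => by
    have := hextra x (i x * c) (i x)
    rw [hi2, mo, hl] at this
    exact this.symm
  have hr : ∀ x c : Q, (c * x) * i x = c := fun x c => rc x _ _ (hr2 x _)
  have ii : ∀ x : Q, i (i x) = x := fun x => by
    apply lc (i x)
    rw [hi, hi2]
  have anti : ∀ x y : Q, i (x * y) = i y * i x := fun x y => by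
    have h1 : y * i (x * y) = i x := by
      apply lc x
      have := hr (x * y) (i x)
      rw [hl2] at this
      rw [this]
    rw [← h1, hl2]
  -- extra autotopism
  have ext : ∀ x a b : Q, (x * a) * (b * i x) = (x * (a * b)) * i x := fun x a b => by
    apply rc x
    have := hextra x a (b * i x)
    rw [hr2] at this
    rw [hr2, this]
  have flexi : ∀ x a : Q, x * (a * i x) = (x * a) * i x := fun x a => by
    have := ext x 1 a
    rwa [mo, om] at this
  -- LCC
  have lcc : ∀ x a b : Q, ((x * a) * i x) * (x * b) = x * (a * b) := fun x a b => by
    have h := ext x (a * b) (i b)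
    rw [hr] at h
    rw [← h, ← anti x b, hr2]
  have rcc : ∀ x a b : Q, (a * i x) * ((x * b) * i x) = (a * b) * i x := fun x a b => by
    have h := ext x (i a) (a * b)
    rw [hl2] at h
    have e : a * i x = i (x * i a) := by rw [anti, ii]
    rw [← h, e, hl2]
  have mouf : ∀ x a b : Q, (x * a) * (b * x) = (x * (a * b)) * x := fun x a b => by
    have h := rcc x ((x * a) * x) b
    rw [hr] at h
    have h2 := lcc x (a * x) (i x * b)
    rw [hl, flex x a, hr] at h2
    have h3 := rcc (i x) a (i x * (b * x))
    have e : i x * (b * x) = (i x * b) * x := by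
      have := flexi (i x) b
      rwa [ii] at this
    have h4 := rcc (i x) a b
    rw [ii] at h4
    have h5 := lcc x (a * x) ((i x * b) * x)
    rw [flex x a, hr, ← e, hl, e, h4] at h5
    rw [h5, flex]
  -- nucleus
  have nl : ∀ m : Q, (∀ x y, m * (x * y) = (m * x) * y) → m ∈ nucleus Q := fun m hm => by
    have hinv : ∀ x y, i m * (x * y) = (i m * x) * y := fun x y => by
      apply lc m
      rw [hl, hm, hl]
    refine ⟨hm, fun q c => ?_, fun x y => ?_⟩
    · have h1 : ∀ p, (p * i m) * (m * c) = p * c := fun p => by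
        have h2 := hm (i p) (p * c)
        rw [hl2] at h2
        rw [h2]
        have : p * i m = i (m * i p) := by rw [anti, ii]
        rw [this, hl2]
      have := h1 (q * m)
      rwa [hr] at this
    · have := congrArg i (hinv (i y) (i x))
      simp only [anti, ii] at this
      exact this.symm
  have ninv : ∀ m ∈ nucleus Q, i m ∈ nucleus Q := fun m hm => nl _ fun x y => by
    apply lc m
    rw [hl, hm.1, hl]
  have nmul : ∀ m ∈ nucleus Q, ∀ k ∈ nucleus Q, m * k ∈ nucleus Q := fun m hm k hk => nl _ fun x y => by
    rw [← hm.1, ← hm.1, ← hm.1, hk.1]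
  have ncj : ∀ x, ∀ m ∈ nucleus Q, (x * m) * i x ∈ nucleus Q := fun x m hm => nl _ fun c d => by
    obtain ⟨a, rfl⟩ : ∃ a, c = x * a := ⟨i x * c, (hl _ _).symm⟩
    obtain ⟨b, rfl⟩ : ∃ b, d = b * i x := ⟨d * x, (hr _ _).symm⟩
    rw [ext, ← flexi x (a * b), lcc, lcc, hm.1, hm.1, ext, flexi]
  have nsq : ∀ x : Q, x * x ∈ nucleus Q := fun x => by
    have key : ∀ a b : Q, a * ((b * x) * x) = ((a * b) * x) * x := fun a b => by
      have h := mouf x (i x * a) (b * x)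
      have h2 := hextra x (i x * a) b
      rw [hl] at h h2
      rw [h, h2]
    have k1 : ∀ a : Q, a * (x * x) = (a * x) * x := fun a => by
      have := key a 1
      rwa [om, mo] at this
    have k2 : ∀ a b : Q, a * (b * (x * x)) = (a * b) * (x * x) := fun a b => by
      rw [k1, key, k1]
    have : i (x * x) ∈ nucleus Q := nl _ fun a b => by
      have := congrArg i (k2 (i b) (i a))
      rw [anti, anti (i a), anti (i b * i a), anti (i b), ii, ii] at this
      exact this.symm
    have := ninv _ this
    rwa [ii] at this
  -- congruence mod nucleus
  obtain ⟨R, hR⟩ : ∃ R : Q → Q → Prop, ∀ a b, R a b ↔ ∃ m ∈ nucleus Q, b = a * m :=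
    ⟨_, fun _ _ => Iff.rfl⟩
  have Rs : ∀ a b, R a b → R b a := fun a b h => by
    obtain ⟨m, hm, rfl⟩ := (hR _ _).1 h
    exact (hR _ _).2 ⟨i m, ninv m hm, (hr _ _).symm⟩
  have Rt : ∀ a b c, R a b → R b c → R a c := fun a b c h h' => by
    obtain ⟨m, hm, rfl⟩ := (hR _ _).1 h
    obtain ⟨k, hk, rfl⟩ := (hR _ _).1 h'
    exact (hR _ _).2 ⟨m * k, nmul m hm k hk, (hk.2.2 _ _).symm⟩
  have Rl : ∀ a b c, R a b → R (c * a) (c * b) := fun a b c h => by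
    obtain ⟨m, hm, rfl⟩ := (hR _ _).1 h
    exact (hR _ _).2 ⟨m, hm, hm.2.2 _ _⟩
  have Rr : ∀ a b c, R a b → R (a * c) (b * c) := fun a b c h => by
    obtain ⟨m, hm, rfl⟩ := (hR _ _).1 h
    refine (hR _ _).2 ⟨(i c * m) * i (i c), ncj _ m hm, ?_⟩
    have h1 := (ncj (i c) m hm).2.2 a c
    have h2 := flexi (i c) m
    rw [← h1, ← h2, ii, hl, hm.2.1]
  have Ri : ∀ a, R (i a) a := fun a => (hR _ _).2 ⟨a * a, nsq a, (hl2 a a).symm⟩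
  have Rc : ∀ a b, R (a * b) (b * a) := fun a b => by
    have h1 := Rs _ _ (Ri (a * b))
    rw [anti] at h1
    exact Rt _ _ _ h1 (Rt _ _ _ (Rr _ _ _ (Ri b)) (Rl _ _ _ (Ri a)))
  have Rsq : ∀ x a, R (x * (x * a)) a := fun x a => by
    have h1 := Rr _ _ (x * a) (Ri x)
    rw [hl2] at h1
    exact Rs _ _ h1
  have Rm : ∀ x a b, R ((x * a) * (x * b)) (a * b) := fun x a b => by
    refine Rt _ _ _ (Rl _ _ _ (Rc x b)) ?_
    rw [mouf]
    exact Rt _ _ _ (Rc _ _) (Rsq _ _)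
  have Rm2 : ∀ x a b, R ((x * a) * b) (a * (x * b)) := fun x a b =>
    Rt _ _ _ (Rs _ _ (Rl _ _ _ (Rsq x b))) (Rm x a (x * b))
  have Ra : ∀ x a b, R (x * (a * b)) ((x * a) * b) := fun x a b =>
    Rt _ _ _ (Rs _ _ (Rm2 a x b)) (Rr _ _ _ (Rc a x))
  -- associators
  obtain ⟨A, hA⟩ : ∃ A : Q → Q → Q → Q, ∀ x y z, A x y z = ld (x * (y * z)) ((x * y) * z) :=
    ⟨_, fun _ _ _ => rfl⟩
  have A1 : ∀ x y z, (x * y) * z = (x * (y * z)) * A x y z := fun x y z => by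
    rw [hA, Loop.mul_ld]
  have An : ∀ x y z, A x y z ∈ nucleus Q := fun x y z => by
    obtain ⟨m, hm, h⟩ := (hR _ _).1 (Ra x y z)
    rw [A1] at h
    rw [lc _ _ _ h]; exact hm
  -- the left inner mapping
  obtain ⟨f, hf⟩ : ∃ f : Q → Q → Q → Q, ∀ x y z, (x * y) * f x y z = x * (y * z) :=
    ⟨fun x y z => i (x * y) * (x * (y * z)), fun x y z => hl _ _⟩
  have fA : ∀ x y z, f x y z * A x y z = z := fun x y z => by
    apply lc (x * y)
    rw [(An x y z).2.2, hf, ← A1]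
  have fhom : ∀ x y a b, f x y (a * b) = f x y a * f x y b := fun x y a b => by
    have h1 : ∀ a, ∃ c, ∀ b, x * (y * (a * b)) = (x * y) * (c * f x y b) := fun a => by
      obtain ⟨p, hp⟩ : ∃ p, p = (x * ((y * a) * i y)) * i x := ⟨_, rfl⟩
      refine ⟨(i (x * y) * p) * i (i (x * y)), fun b => ?_⟩
      have e2 := lcc (i (x * y)) p (x * (y * b))
      rw [← lcc y a b, ← lcc x, ← hp, ← hf x y b]
      rw [← hf x y b, hl2] at e2
      rw [e2, hl]
    obtain ⟨c, hc⟩ := h1 a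
    have f1 : f x y 1 = 1 := by
      apply lc (x * y)
      rw [hf, mo, mo]
    have h2 := hc 1
    rw [f1, mo, mo, ← hf] at h2
    have h3 := hc b
    rw [← lc _ _ _ h2, ← hf] at h3
    exact lc _ _ _ h3
  have fn : ∀ x y, ∀ m ∈ nucleus Q, f x y m = m := fun x y m hm => by
    apply lc (x * y)
    rw [hf, hm.2.2]
  have fx : ∀ x y, f x y x = x := fun x y => by
    apply lc (x * y)
    rw [hf, flex]
  -- order two
  have A2 : ∀ x y z, A x y z * A x y z = 1 := fun x y z => by
    have h1 := fA x y (z * x)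
    rw [fhom, fx] at h1
    have hn := An x y z
    have hm := An x y (z * x)
    have h0 := fA x y z
    have hx : x * A x y (z * x) = A x y z * x := by
      apply lc (f x y z)
      rw [hn.2.1, h0, hm.2.2, h1]
    have h3 := A1 x y (z * x)
    rw [hextra, mouf, A1 x y z] at h3
    have h4 : x = A x y z * (x * A x y (z * x)) := by
      apply lc (x * (y * z))
      rw [hm.2.2, hm.2.2, hn.2.1]
      exact h3
    rw [hx, hn.1] at h4
    apply rc x
    rw [← h4, om]
  have Az : ∀ x y z, A x y z * z = z * A x y z := fun x y z => by
    have h1 := fhom x y z z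
    rw [fn x y _ (nsq z)] at h1
    have hn := An x y z
    have h0 : f x y z = z * A x y z := by
      have := hn.2.2 (f x y z) (A x y z)
      rw [A2, mo, fA] at this
      exact this
    rw [h0, ← hn.2.1] at h1
    have h2 := lc _ _ _ h1
    apply lc (A x y z)
    rw [← h2, hn.1, A2, om]
  have Ax : ∀ x y z, A x y z * x = x * A x y z := fun x y z => by
    have h1 := fA x y (z * x)
    rw [fhom, fx] at h1
    have hn := An x y z
    have hm := An x y (z * x)
    have h0 := fA x y z
    have hx : x * A x y (z * x) = A x y z * x := by
      apply lc (f x y z)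
      rw [hn.2.1, h0, hm.2.2, h1]
    have h2 := Az x y (z * x)
    rw [← hm.2.2, hx, hn.2.1, ← Az, ← hn.1] at h2
    rw [rc _ _ _ h2] at hx
    exact hx.symm
  have Ay : ∀ x y z, A x y z * y = y * A x y z := fun x y z => by
    have hn := An x y z
    have e : A (x * y) (i y) (y * z) = A x y z := by
      have h := A1 (x * y) (i y) (y * z)
      rw [hr, hl2, A1 x y z, ← (An (x * y) (i y) (y * z)).2.2] at h
      apply lc (A x y z)
      rw [A2]
      apply lc (x * (y * z))
      rw [mo, ← h]
    have h := Ax (x * y) (i y) (y * z)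
    rw [e, hn.1, Ax, ← hn.2.1, ← hn.2.2] at h
    exact lc _ _ _ h
  intro x y z
  rw [← hA]
  have hn := An x y z
  refine ⟨?_, A2 x y z, Ax x y z, Ay x y z, Az x y z⟩
  have hP : A x y z * (x * (y * z)) = (x * (y * z)) * A x y z := by
    rw [hn.1, Ax, ← hn.2.1, hn.1, Ay, ← hn.2.1, Az, ← hn.2.2, ← hn.2.2]
  apply rc ((x * y) * z)
  rw [Loop.rd_mul, A1, hn.1, hP, ← hn.2.2, A2, mo]
end

section
/- In a CC-loop, if c is a power-associative WIP element, then every power of c is a WIP element: for all n ∈ ℕ, cⁿ is a WIP element, and (c⁻¹)ⁿ is a WIP element, where c⁻¹ := c\1. -/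
open Loop

namespace CCW

variable {Q : Type*} [Loop Q]

def L (x : Q) : Equiv.Perm Q where
  toFun y := x * y
  invFun y := ld x y
  left_inv y := Loop.ld_mul x y
  right_inv y := Loop.mul_ld x y

def R (x : Q) : Equiv.Perm Q where
  toFun y := y * x
  invFun y := rd y x
  left_inv y := Loop.mul_rd y x
  right_inv y := Loop.rd_mul y x

theorem ld_eq {a b c : Q} (h : a * b = c) : ld a c = b := by
  rw [← h, Loop.ld_mul]

theorem rd_eq {a b c : Q} (h : a * b = c) : rd c b = a := by
  rw [← h, Loop.mul_rd]

def rho : Equiv.Perm Q where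
  toFun y := ld y 1
  invFun y := rd 1 y
  left_inv y := rd_eq (Loop.mul_ld y 1)
  right_inv y := ld_eq (Loop.rd_mul 1 y)

theorem L_apply (x y : Q) : L x y = x * y := rfl
theorem R_apply (x y : Q) : R x y = y * x := rfl
theorem rho_apply (y : Q) : rho y = ld y 1 := rfl

theorem L_one : L (1 : Q) = 1 := by
  ext y; exact Loop.one_mul y
theorem R_one : R (1 : Q) = 1 := by
  ext y; exact Loop.mul_one y

theorem wip_iff (c : Q) : IsWIP c ↔ L c * rho * R c = rho := by
  constructor
  · intro h; ext x; exact h x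
  · intro h x; exact congrArg (fun f : Equiv.Perm Q => f x) h

def Atp (A B C : Equiv.Perm Q) : Prop := ∀ u v, A u * B v = C (u * v)

theorem Atp.mul {A B C A' B' C' : Equiv.Perm Q} (h : Atp A B C) (h' : Atp A' B' C') :
    Atp (A * A') (B * B') (C * C') := by
  intro u v
  simp only [Equiv.Perm.mul_apply]
  rw [h, h']

theorem Atp.inv {A B C : Equiv.Perm Q} (h : Atp A B C) : Atp A⁻¹ B⁻¹ C⁻¹ := by
  intro u v
  have := h (A⁻¹ u) (B⁻¹ v)
  have e1 : A (A⁻¹ u) = u := Equiv.apply_symm_apply A u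
  have e2 : B (B⁻¹ v) = v := Equiv.apply_symm_apply B v
  rw [e1, e2] at this
  rw [this]
  exact (Equiv.symm_apply_apply C _).symm

theorem atp_a (hcc : IsCC Q) (x : Q) : Atp ((R x)⁻¹ * L x) (L x) (L x) := by
  intro u v
  exact (hcc.1 x u v).symm

theorem atp_b (hcc : IsCC Q) (x : Q) : Atp (R x) ((L x)⁻¹ * R x) (R x) := by
  intro u v
  exact (hcc.2 x v u).symm

theorem comm_L {f : Equiv.Perm Q} (h : Atp f f f) {s : Q} (hs : f s = s) : f * L s = L s * f := by
  ext v
  have := h s v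
  rw [hs] at this
  exact this.symm

theorem comm_R {f : Equiv.Perm Q} (h : Atp f f f) {s : Q} (hs : f s = s) : f * R s = R s * f := by
  ext v
  have := h v s
  rw [hs] at this
  exact this.symm

theorem comm_rho {f : Equiv.Perm Q} (h : Atp f f f) (h1 : f 1 = 1) : f * rho = rho * f := by
  ext v
  have := h v (ld v 1)
  rw [Loop.mul_ld, h1] at this
  exact (ld_eq this).symm

/-- good set -/
structure Good (S : Set Q) : Prop where
  sub : IsSubloop S
  assoc : ∀ x ∈ S, ∀ y ∈ S, ∀ z ∈ S, x * (y * z) = (x * y) * z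
  comm : ∀ x ∈ S, ∀ y ∈ S, x * y = y * x

theorem LL (hcc : IsCC Q) {x y : Q} (h : x * y = y * x) : L x * L y = L y * L x := by
  ext z
  have := hcc.1 x y z
  rw [rd_eq h.symm] at this
  exact this

theorem RR (hcc : IsCC Q) {x y : Q} (h : x * y = y * x) : R x * R y = R y * R x := by
  ext z
  have := hcc.2 x y z
  rw [ld_eq h] at this
  exact this

theorem phi_fix {S : Set Q} (hS : Good S) {x y s : Q} (hx : x ∈ S) (hy : y ∈ S) (hs : s ∈ S) :
    (L y * L x * (L (y * x))⁻¹) s = s := by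
  have hm : ld (y * x) s ∈ S := hS.sub.2.2.1 _ (hS.sub.2.1 _ hy _ hx) _ hs
  change y * (x * ld (y * x) s) = s
  rw [hS.assoc _ hy _ hx _ hm, Loop.mul_ld]

theorem psi_fix {S : Set Q} (hS : Good S) {x y s : Q} (hx : x ∈ S) (hy : y ∈ S) (hs : s ∈ S) :
    (R y * R x * (R (y * x))⁻¹) s = s := by
  have hm : rd s (y * x) ∈ S := hS.sub.2.2.2 _ hs _ (hS.sub.2.1 _ hy _ hx)
  change rd s (y * x) * x * y = s
  rw [← hS.assoc _ hm _ hx _ hy, hS.comm _ hx _ hy, Loop.rd_mul]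

theorem key1 (hcc : IsCC Q) {S : Set Q} (hS : Good S) {x y : Q} (hx : x ∈ S) (hy : y ∈ S) :
    (R y)⁻¹ * L y * ((R x)⁻¹ * L x) * ((R (y * x))⁻¹ * L (y * x))⁻¹ =
      L y * L x * (L (y * x))⁻¹ := by
  have h := ((atp_a hcc y).mul (atp_a hcc x)).mul (atp_a hcc (y * x)).inv
  ext u
  have := h u 1
  rwa [phi_fix hS hx hy hS.sub.1, Loop.mul_one, Loop.mul_one] at this

theorem key2 (hcc : IsCC Q) {S : Set Q} (hS : Good S) {x y : Q} (hx : x ∈ S) (hy : y ∈ S) :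
    (L y)⁻¹ * R y * ((L x)⁻¹ * R x) * ((L (y * x))⁻¹ * R (y * x))⁻¹ =
      R y * R x * (R (y * x))⁻¹ := by
  have h := ((atp_b hcc y).mul (atp_b hcc x)).mul (atp_b hcc (y * x)).inv
  ext u
  have := h 1 u
  rwa [psi_fix hS hx hy hS.sub.1, Loop.one_mul, Loop.one_mul] at this

theorem phi_aut (hcc : IsCC Q) {S : Set Q} (hS : Good S) {x y : Q} (hx : x ∈ S) (hy : y ∈ S) :
    Atp (L y * L x * (L (y * x))⁻¹) (L y * L x * (L (y * x))⁻¹) (L y * L x * (L (y * x))⁻¹) := by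
  have h := ((atp_a hcc y).mul (atp_a hcc x)).mul (atp_a hcc (y * x)).inv
  rwa [key1 hcc hS hx hy] at h

theorem psi_aut (hcc : IsCC Q) {S : Set Q} (hS : Good S) {x y : Q} (hx : x ∈ S) (hy : y ∈ S) :
    Atp (R y * R x * (R (y * x))⁻¹) (R y * R x * (R (y * x))⁻¹) (R y * R x * (R (y * x))⁻¹) := by
  have h := ((atp_b hcc y).mul (atp_b hcc x)).mul (atp_b hcc (y * x)).inv
  rwa [key2 hcc hS hx hy] at h

theorem grp {G : Type*} [Group G] {l m n r s t p q : G}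
    (hp : l * m = p * n) (hq : r * s = q * t)
    (hlm : l * m = m * l) (hrs : r * s = s * r)
    (hpt : p * t = t * p) (hpl : p * l = l * p) (hps : p * s = s * p)
    (hqn : q * n = n * q) (hqs : q * s = s * q)
    (k1 : r⁻¹ * l * (s⁻¹ * m) * (t⁻¹ * n)⁻¹ = p)
    (k2 : m⁻¹ * s * (l⁻¹ * r) * (n⁻¹ * t)⁻¹ = q) : p * q = 1 := by
  have hm : m = l⁻¹ * p * n := by rw [mul_assoc, ← hp]; group
  have hr : r = q * t * s⁻¹ := by rw [← hq]; group
  have e1 : r⁻¹ * l * s⁻¹ * l⁻¹ * t = 1 := by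
    have : r⁻¹ * l * s⁻¹ * l⁻¹ * (p * t) = p := by
      refine Eq.trans ?_ k1
      rw [hm]; group
    rw [hpt] at this
    calc r⁻¹ * l * s⁻¹ * l⁻¹ * t = (r⁻¹ * l * s⁻¹ * l⁻¹ * (t * p)) * p⁻¹ := by group
      _ = 1 := by rw [this]; group
  have e1' : l * s * l⁻¹ = t * r⁻¹ := by
    calc l * s * l⁻¹ = t * (r⁻¹ * l * s⁻¹ * l⁻¹ * t)⁻¹ * r⁻¹ := by group
      _ = _ := by rw [e1]; group
  have e2 : m⁻¹ * s * l⁻¹ * s⁻¹ * n = 1 := by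
    have h : r * t⁻¹ = s⁻¹ * q := by
      have : r = s⁻¹ * (q * t) := by rw [← hq, hrs]; group
      rw [this]; group
    have : m⁻¹ * s * l⁻¹ * s⁻¹ * (q * n) = q := by
      calc m⁻¹ * s * l⁻¹ * s⁻¹ * (q * n) = m⁻¹ * s * l⁻¹ * (s⁻¹ * q) * n := by group
        _ = q := by rw [← h]; refine Eq.trans ?_ k2; group
    rw [hqn] at this
    calc m⁻¹ * s * l⁻¹ * s⁻¹ * n = (m⁻¹ * s * l⁻¹ * s⁻¹ * (n * q)) * q⁻¹ := by group
      _ = 1 := by rw [this]; group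
  have e3 : s * l⁻¹ * s⁻¹ = l⁻¹ * p := by
    calc s * l⁻¹ * s⁻¹ = m * (m⁻¹ * s * l⁻¹ * s⁻¹ * n) * n⁻¹ := by group
      _ = l⁻¹ * p := by rw [e2, hm]; group
  have e4 : t * r⁻¹ = p * s := by
    rw [← e1']
    calc l * s * l⁻¹ = l * (s * l⁻¹ * s⁻¹) * s := by group
      _ = _ := by rw [e3]; group
  have h : r = s⁻¹ * q * t := by rw [mul_assoc, ← hq, hrs]; group
  have e5 : p * s * (s⁻¹ * q) = 1 := by
    calc p * s * (s⁻¹ * q) = t * r⁻¹ * (s⁻¹ * q * t) * t⁻¹ := by rw [e4]; group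
      _ = 1 := by rw [← h]; group
  calc p * q = p * s * (s⁻¹ * q) := by group
    _ = 1 := e5

theorem pq (hcc : IsCC Q) {S : Set Q} (hS : Good S) {x y : Q} (hx : x ∈ S) (hy : y ∈ S) :
    (L y * L x * (L (y * x))⁻¹) * (R y * R x * (R (y * x))⁻¹) = 1 := by
  have hyx := hS.sub.2.1 _ hy _ hx
  have hc := hS.comm _ hx _ hy
  refine grp (l := L y) (m := L x) (n := L (y * x)) (r := R y) (s := R x) (t := R (y * x))
    (by group) (by group) (LL hcc hc.symm) (RR hcc hc.symm)
    (comm_R (phi_aut hcc hS hx hy) (phi_fix hS hx hy hyx))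
    (comm_L (phi_aut hcc hS hx hy) (phi_fix hS hx hy hy))
    (comm_R (phi_aut hcc hS hx hy) (phi_fix hS hx hy hx))
    (comm_L (psi_aut hcc hS hx hy) (psi_fix hS hx hy hyx))
    (comm_R (psi_aut hcc hS hx hy) (psi_fix hS hx hy hx))
    (key1 hcc hS hx hy) ?_
  have := key2 hcc hS hy hx
  rw [hc, RR hcc hc] at this
  exact this

theorem wip_mul (hcc : IsCC Q) {S : Set Q} (hS : Good S) {x y : Q} (hx : x ∈ S) (hy : y ∈ S)
    (wx : IsWIP x) (wy : IsWIP y) : IsWIP (y * x) := by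
  rw [wip_iff] at *
  have hyx := hS.sub.2.1 _ hy _ hx
  have hc := hS.comm _ hx _ hy
  have h := pq hcc hS hx hy
  have c1 := comm_L (psi_aut hcc hS hx hy) (psi_fix hS hx hy hyx)
  have c2 := comm_rho (psi_aut hcc hS hx hy) (psi_fix hS hx hy hS.sub.1)
  have c3 : L y * L x = (L y * L x * (L (y * x))⁻¹) * L (y * x) := by group
  have c4 : R x * R y = (R y * R x * (R (y * x))⁻¹) * R (y * x) := by rw [RR hcc hc]; group
  generalize L y * L x * (L (y * x))⁻¹ = p at *
  generalize R y * R x * (R (y * x))⁻¹ = q at *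
  calc L (y * x) * rho * R (y * x) = (p * q) * L (y * x) * rho * R (y * x) := by rw [h]; group
    _ = p * (q * L (y * x)) * rho * R (y * x) := by group
    _ = p * L (y * x) * (q * rho) * R (y * x) := by rw [c1]; group
    _ = (p * L (y * x)) * rho * (q * R (y * x)) := by rw [c2]; group
    _ = L y * (L x * rho * R x) * R y := by rw [← c3, ← c4]; group
    _ = rho := by rw [wx, wy]

theorem wip_inv (hcc : IsCC Q) {S : Set Q} (hS : Good S) {x y : Q} (hx : x ∈ S) (hy : y ∈ S)
    (wx : IsWIP x) (hyx1 : y * x = 1) : IsWIP y := by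
  rw [wip_iff] at *
  have hc := hS.comm _ hx _ hy
  have h := pq hcc hS hx hy
  have c1 := comm_L (psi_aut hcc hS hx hy) (psi_fix hS hx hy hx)
  have c2 := comm_rho (psi_aut hcc hS hx hy) (psi_fix hS hx hy hS.sub.1)
  have c5 := comm_R (psi_aut hcc hS hx hy) (psi_fix hS hx hy hx)
  rw [hyx1, L_one, R_one, inv_one, _root_.mul_one, _root_.mul_one] at *
  have c3 : L y = (L y * L x) * (L x)⁻¹ := by group
  have c4 : R y = (R y * R x) * (R x)⁻¹ := by group
  generalize L y * L x = p at *
  generalize R y * R x = q at *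
  have c1' : (L x)⁻¹ * q = q * (L x)⁻¹ := by
    calc (L x)⁻¹ * q = (L x)⁻¹ * (q * L x) * (L x)⁻¹ := by group
      _ = _ := by rw [c1]; group
  have wx' : (L x)⁻¹ * rho * (R x)⁻¹ = rho := by
    nth_rewrite 1 [← wx]; group
  calc L y * rho * R y = p * (L x)⁻¹ * (rho * q) * (R x)⁻¹ := by rw [c3, c4]; group
    _ = p * ((L x)⁻¹ * q) * rho * (R x)⁻¹ := by rw [← c2]; group
    _ = (p * q) * ((L x)⁻¹ * rho * (R x)⁻¹) := by rw [c1']; group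
    _ = rho := by rw [h, wx']; group

theorem closure_sub (T : Set Q) : IsSubloop (Loop.closure T) := by
  refine ⟨?_, ?_, ?_, ?_⟩
  · rintro U ⟨hU, _⟩; exact hU.1
  · intro a ha b hb U hU; exact hU.1.2.1 _ (ha U hU) _ (hb U hU)
  · intro a ha b hb U hU; exact hU.1.2.2.1 _ (ha U hU) _ (hb U hU)
  · intro a ha b hb U hU; exact hU.1.2.2.2 _ (ha U hU) _ (hb U hU)

theorem cent_sub {S : Set Q} (hS : IsSubloop S)
    (assoc : ∀ x ∈ S, ∀ y ∈ S, ∀ z ∈ S, x * (y * z) = (x * y) * z) {t : Q} (ht : t ∈ S) :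
    IsSubloop {s | s ∈ S ∧ s * t = t * s} := by
  refine ⟨⟨hS.1, by rw [Loop.one_mul, Loop.mul_one]⟩, ?_, ?_, ?_⟩
  · rintro a ⟨ha, ha'⟩ b ⟨hb, hb'⟩
    refine ⟨hS.2.1 _ ha _ hb, ?_⟩
    rw [← assoc _ ha _ hb _ ht, hb', assoc _ ha _ ht _ hb, ha', assoc _ ht _ ha _ hb]
  · rintro a ⟨ha, ha'⟩ b ⟨hb, hb'⟩
    have hd := hS.2.2.1 _ ha _ hb
    refine ⟨hd, ?_⟩
    apply (L a).injective
    change a * (ld a b * t) = a * (t * ld a b)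
    rw [assoc _ ha _ hd _ ht, Loop.mul_ld, hb', assoc _ ha _ ht _ hd, ha',
      ← assoc _ ht _ ha _ hd, Loop.mul_ld]
  · rintro a ⟨ha, ha'⟩ b ⟨hb, hb'⟩
    have hd := hS.2.2.2 _ ha _ hb
    refine ⟨hd, ?_⟩
    apply (R b).injective
    change (rd a b * t) * b = (t * rd a b) * b
    rw [← assoc _ hd _ ht _ hb, ← hb', assoc _ hd _ hb _ ht, Loop.rd_mul,
      ← assoc _ ht _ hd _ hb, Loop.rd_mul, ha']

theorem good {c : Q} (hpa : IsPA c) : Good (Loop.closure {c}) := by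
  have hS := closure_sub ({c} : Set Q)
  have hc : c ∈ Loop.closure {c} := fun U hU => hU.2 rfl
  have h1 : ∀ s ∈ Loop.closure {c}, s * c = c * s := by
    intro s hs
    exact (hs _ ⟨cent_sub hS hpa hc, by rintro _ rfl; exact ⟨hc, rfl⟩⟩).2
  refine ⟨hS, hpa, ?_⟩
  intro s hs t ht
  exact (hs _ ⟨cent_sub hS hpa ht, by rintro _ rfl; exact ⟨hc, (h1 t ht).symm⟩⟩).2

theorem wip_pow (hcc : IsCC Q) {S : Set Q} (hS : Good S) {x : Q} (hx : x ∈ S)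
    (wx : IsWIP x) (n : ℕ) : Loop.pow x n ∈ S ∧ IsWIP (Loop.pow x n) := by
  induction n with
  | zero => exact ⟨hS.sub.1, by intro z; change 1 * ld (z * 1) 1 = _; rw [Loop.one_mul, Loop.mul_one]⟩
  | succ n ih => exact ⟨hS.sub.2.1 _ hx _ ih.1, wip_mul hcc hS ih.1 hx ih.2 wx⟩

end CCW

/-- In a CC-loop, every power of a power-associative WIP element is
a WIP element. -/
theorem stmt_12 {Q : Type*} [Loop Q] (hcc : IsCC Q) (c : Q)
    (hpa : IsPA c) (hwip : IsWIP c) :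
    ∀ n : ℕ, IsWIP (pow c n) ∧ IsWIP (pow (ld c 1) n) := by
  intro n
  have hS := CCW.good hpa
  have hc : c ∈ Loop.closure {c} := fun U hU => hU.2 rfl
  have hd := hS.sub.2.2.1 _ hc _ hS.sub.1
  have hdc : ld c 1 * c = 1 := by rw [hS.comm _ hd _ hc, Loop.mul_ld]
  exact ⟨(CCW.wip_pow hcc hS hc hwip n).2,
    (CCW.wip_pow hcc hS hd (CCW.wip_inv hcc hS hc hd hwip hdc) n).2⟩
end

section
/- In a CC-loop, let b and c be power-associative elements. Then the subloop ⟨b,c⟩ generated by {b,c} is a group (i.e., associates) if and only if (c·b)·b⁻¹ = c and (b·c)·c⁻¹ = b. If in addition c is a WIP element, then (c·b)·b⁻¹ = c holds if and only if (b·c)·c⁻¹ = b holds. -/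
namespace LoopAux

variable {Q : Type*} [Loop Q]

local notation "N" => Loop.nucleus

theorem lc {x y z : Q} (h : x * y = x * z) : y = z := by
  rw [← Loop.ld_mul x y, h, Loop.ld_mul]

theorem rc {x y z : Q} (h : y * x = z * x) : y = z := by
  rw [← Loop.mul_rd y x, h, Loop.mul_rd]

theorem one_nuc : (1 : Q) ∈ N Q := by
  refine ⟨?_, ?_, ?_⟩ <;> intro x y <;> simp [Loop.one_mul, Loop.mul_one]

theorem mul_nuc {a b : Q} (ha : a ∈ N Q) (hb : b ∈ N Q) : a * b ∈ N Q := by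
  obtain ⟨a1, a2, a3⟩ := ha
  obtain ⟨b1, b2, b3⟩ := hb
  refine ⟨fun x y => ?_, fun x y => ?_, fun x y => ?_⟩
  · rw [← a1 b (x * y), b1, a1, a1]
  · rw [← a1 b y, a2, b2, b3]
  · rw [b3, b3, a3, ← b3]

theorem nuc_mid (hcc : Loop.IsCC Q) {a : Q} (h : ∀ w y, w * (a * y) = (w * a) * y) :
    a ∈ N Q := by
  refine ⟨fun x y => ?_, h, fun x y => ?_⟩
  · rw [hcc.1, h, Loop.rd_mul]
  · rw [hcc.2 a y x, ← h, Loop.mul_ld]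

theorem nuc_left (hcc : Loop.IsCC Q) {a : Q} (h : ∀ x y, a * (x * y) = (a * x) * y) :
    a ∈ N Q := by
  refine nuc_mid hcc fun u z => ?_
  have h1 := hcc.1 a (Loop.ld a (u * a)) z
  rw [h, Loop.mul_ld, Loop.mul_rd] at h1
  exact h1.symm

theorem nuc_right (hcc : Loop.IsCC Q) {a : Q} (h : ∀ x y, x * (y * a) = (x * y) * a) :
    a ∈ N Q := by
  refine nuc_mid hcc fun z v => ?_
  have h1 := hcc.2 a (Loop.rd (a * v) a) z
  rw [← h, Loop.rd_mul, Loop.ld_mul] at h1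
  exact h1

theorem norm1 (hcc : Loop.IsCC Q) {n : Q} (hn : n ∈ N Q) (x : Q) :
    ∃ m ∈ N Q, x * n = m * x := by
  refine ⟨Loop.rd (x * n) x, nuc_left hcc ?_, (Loop.rd_mul _ _).symm⟩
  set m := Loop.rd (x * n) x with hm
  have key : ∀ y z, m * (y * z) = Loop.rd (x * (n * Loop.ld x (y * x))) x * z := by
    intro y z
    have h1 := hcc.1 x (Loop.ld x (y * x)) (Loop.ld x z)
    rw [Loop.mul_ld, Loop.mul_rd, Loop.mul_ld] at h1
    rw [← h1, hm, ← hcc.1, hn.1, hcc.1, Loop.mul_ld]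
  intro y z
  have h1 := key y 1
  rw [Loop.mul_one, Loop.mul_one] at h1
  rw [key, h1]

theorem norm2 (hcc : Loop.IsCC Q) {n : Q} (hn : n ∈ N Q) (x : Q) :
    ∃ m ∈ N Q, n * x = x * m := by
  refine ⟨Loop.ld x (n * x), nuc_right hcc ?_, (Loop.mul_ld _ _).symm⟩
  set m := Loop.ld x (n * x) with hm
  have key : ∀ y z, (y * z) * m = y * Loop.ld x ((Loop.rd (x * z) x * n) * x) := by
    intro y z
    have h1 := hcc.2 x (Loop.rd (x * z) x) (Loop.rd y x)
    rw [Loop.rd_mul, Loop.rd_mul, Loop.ld_mul] at h1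
    rw [← h1, hm, ← hcc.2, ← hn.2.2, hcc.2, Loop.rd_mul]
  intro y z
  have h1 := key 1 z
  rw [Loop.one_mul, Loop.one_mul] at h1
  rw [key, h1]

theorem inv_left {a : Q} (ha : a ∈ N Q) : Loop.ld a 1 * a = 1 := by
  apply lc (x := a)
  rw [ha.1, Loop.mul_ld, Loop.one_mul, Loop.mul_one]

theorem inv_nuc' {a : Q} (ha : a ∈ N Q) : Loop.ld a 1 ∈ N Q := by
  have e1 : a * Loop.ld a 1 = 1 := Loop.mul_ld _ _
  have e2 := inv_left ha
  set b := Loop.ld a 1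
  have l1 : ∀ y, a * (b * y) = y := fun y => by rw [ha.1, e1, Loop.one_mul]
  have l2 : ∀ y, b * (a * y) = y := fun y => by rw [ha.2.1, e2, Loop.one_mul]
  have r1 : ∀ y, (y * b) * a = y := fun y => by rw [← ha.2.2, e2, Loop.mul_one]
  have r2 : ∀ y, (y * a) * b = y := fun y => by rw [← ha.2.1, e1, Loop.mul_one]
  refine ⟨fun x y => ?_, fun x y => ?_, fun x y => ?_⟩
  · apply lc (x := a)
    rw [l1, ha.1, l1]
  · have := ha.2.1 (x * b) (b * y)
    rw [l1, r1] at this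
    exact this.symm
  · apply rc (x := a)
    rw [r1, ← ha.2.2, r1]

/-- Congruence modulo the nucleus. -/
def Sim (x y : Q) : Prop := ∃ n ∈ N Q, x = y * n

theorem Sim.symm {x y : Q} (h : Sim x y) : Sim y x := by
  obtain ⟨n, hn, rfl⟩ := h
  exact ⟨_, inv_nuc' hn, by rw [← hn.2.1, Loop.mul_ld, Loop.mul_one]⟩

theorem Sim.trans {x y z : Q} (h : Sim x y) (h' : Sim y z) : Sim x z := by
  obtain ⟨n, hn, rfl⟩ := h
  obtain ⟨m, hm, rfl⟩ := h'
  exact ⟨_, mul_nuc hm hn, by rw [hm.2.1]⟩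

theorem Sim.mul_left {x y : Q} (h : Sim x y) (z : Q) : Sim (z * x) (z * y) := by
  obtain ⟨n, hn, rfl⟩ := h
  exact ⟨n, hn, hn.2.2 _ _⟩

theorem Sim.left (hcc : Loop.IsCC Q) {x y : Q} (h : Sim x y) : ∃ n ∈ N Q, x = n * y := by
  obtain ⟨n, hn, rfl⟩ := h
  exact norm1 hcc hn y

/-- Left translation. -/
def L (x : Q) : Equiv.Perm Q :=
  ⟨fun y => x * y, fun y => Loop.ld x y, Loop.ld_mul x, Loop.mul_ld x⟩

/-- Right translation. -/
def R (x : Q) : Equiv.Perm Q :=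
  ⟨fun y => y * x, fun y => Loop.rd y x, fun y => Loop.mul_rd y x, fun y => Loop.rd_mul y x⟩

theorem L_app (x y : Q) : L x y = x * y := rfl
theorem R_app (x y : Q) : R x y = y * x := rfl
theorem Li_app (x y : Q) : (L x)⁻¹ y = Loop.ld x y := rfl
theorem Ri_app (x y : Q) : (R x)⁻¹ y = Loop.rd y x := rfl

variable (Q) in
/-- The autotopism group. -/
def Atp : Subgroup (Equiv.Perm Q × Equiv.Perm Q × Equiv.Perm Q) where
  carrier := {t | ∀ x y, t.1 x * t.2.1 y = t.2.2 (x * y)}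
  one_mem' := by intro x y; rfl
  mul_mem' := by
    intro s t hs ht x y
    have h1 := hs (t.1 x) (t.2.1 y)
    rw [ht] at h1
    exact h1
  inv_mem' := by
    intro t ht x y
    have h1 := ht (t.1⁻¹ x) (t.2.1⁻¹ y)
    change t.1⁻¹ x * t.2.1⁻¹ y = t.2.2⁻¹ (x * y)
    apply t.2.2.injective
    rw [← h1]
    simp

theorem atp_nuc (hcc : Loop.IsCC Q) {α β γ : Equiv.Perm Q} (hg : γ = 1)
    (h : (α, β, γ) ∈ Atp Q) : β 1 ∈ N Q := by
  subst hg
  have h' : ∀ x y, α x * β y = x * y := h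
  have e1 : ∀ w, α (w * β 1) = w := fun w => by
    apply rc (x := β 1)
    rw [h', Loop.mul_one]
  have e2 : ∀ w y, (w * β 1) * y = w * β y := fun w y => by rw [← h', e1]
  refine nuc_mid hcc fun w y => ?_
  have e3 := e2 1 y
  rw [Loop.one_mul, Loop.one_mul] at e3
  rw [e2, e3]

/-- The left autotopism. -/
def A (x : Q) : Equiv.Perm Q × Equiv.Perm Q × Equiv.Perm Q := ((R x)⁻¹ * L x, L x, L x)
/-- The right autotopism. -/
def B (x : Q) : Equiv.Perm Q × Equiv.Perm Q × Equiv.Perm Q := (R x, (L x)⁻¹ * R x, R x)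

theorem A_mem (hcc : Loop.IsCC Q) (x : Q) : A x ∈ Atp Q := fun y z => (hcc.1 x y z).symm
theorem B_mem (hcc : Loop.IsCC Q) (x : Q) : B x ∈ Atp Q := fun y z => (hcc.2 x z y).symm

theorem rel1 (hcc : Loop.IsCC Q) (x z : Q) : L x * R z = R (x * z) * (R x)⁻¹ * L x := by
  ext y; exact hcc.1 x y z

theorem rel2 (hcc : Loop.IsCC Q) (x z : Q) : R x * L z = L (z * x) * (L x)⁻¹ * R x := by
  ext y; exact hcc.2 x y z

theorem comm1 (hcc : Loop.IsCC Q) (x y : Q) :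
    L x * R y * (L x)⁻¹ * (R y)⁻¹ = R (x * y) * (R x)⁻¹ * (R y)⁻¹ := by
  rw [rel1 hcc]; group

theorem comm2 (hcc : Loop.IsCC Q) (x y : Q) :
    L x * R y * (L x)⁻¹ * (R y)⁻¹ = L x * L y * (L (x * y))⁻¹ := by
  have h := rel2 hcc y x
  have h2 : R y * L x * (R y)⁻¹ * (L x)⁻¹ = L (x * y) * (L y)⁻¹ * (L x)⁻¹ := by
    rw [h]; group
  have h3 := congrArg (fun t => t⁻¹) h2
  simp only [mul_inv_rev, inv_inv] at h3
  simpa [mul_assoc] using h3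

theorem P_nuc (hcc : Loop.IsCC Q) (x y : Q) :
    (L x * L y * (L (x * y))⁻¹) 1 ∈ N Q := by
  have hW := mul_mem (mul_mem (A_mem hcc x) (A_mem hcc y)) (inv_mem (A_mem hcc (x * y)))
  have hV := mul_mem (mul_mem (B_mem hcc (x * y)) (inv_mem (B_mem hcc x)))
    (inv_mem (B_mem hcc y))
  have h := mul_mem hW (inv_mem hV)
  have h2 := atp_nuc (α := _) (β := _) (γ := _) hcc ?_ h
  · convert h2 using 1
    simp only [A, B, Prod.fst_mul, Prod.snd_mul, Prod.fst_inv, Prod.snd_inv, mul_inv_rev,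
      inv_inv, Equiv.Perm.mul_apply, L_app, R_app, Li_app, Ri_app, Loop.one_mul, Loop.mul_one]
    have t : ∀ z : Q, Loop.ld z z = 1 := fun z => by
      apply lc (x := z); rw [Loop.mul_ld, Loop.mul_one]
    have t' : ∀ z : Q, Loop.rd z z = 1 := fun z => by
      apply rc (x := z); rw [Loop.rd_mul, Loop.one_mul]
    simp only [t, t', Loop.mul_one, Loop.one_mul]
  · simp only [A, B, Prod.snd_mul, Prod.snd_inv]
    rw [← comm1 hcc, ← comm2 hcc, mul_inv_cancel]

theorem comm_aux (hcc : Loop.IsCC Q) (x y : Q) :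
    Sim (Loop.ld x 1 * y) (y * Loop.ld x 1) := by
  have hW := mul_mem (mul_mem (A_mem hcc x) (A_mem hcc y)) (inv_mem (A_mem hcc (x * y)))
  have hV := mul_mem (mul_mem (mul_mem (A_mem hcc x) (B_mem hcc y)) (inv_mem (A_mem hcc x)))
    (inv_mem (B_mem hcc y))
  have h := mul_mem (inv_mem hV) hW
  have hp := P_nuc hcc x y
  have h2 := atp_nuc (α := _) (β := _) (γ := _) hcc ?_ h
  · simp only [A, B, Prod.fst_mul, Prod.snd_mul, Prod.fst_inv, Prod.snd_inv, mul_inv_rev,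
      inv_inv, Equiv.Perm.mul_apply, L_app, R_app, Li_app, Ri_app] at h2 hp
    generalize x * (y * Loop.ld (x * y) 1) = p at hp h2
    set a := Loop.ld y (x * Loop.rd (y * Loop.ld x p) y * y) with ha
    obtain ⟨a', ha', e⟩ := norm1 hcc h2 y
    have e1 : x * Loop.rd (y * Loop.ld x p) y = a' := by
      apply rc (x := y)
      rw [← e, ha, Loop.mul_ld]
    have e2 : ∀ q ∈ N Q, Loop.ld x q = Loop.ld x 1 * q := fun q hq => by
      apply lc (x := x)
      rw [Loop.mul_ld, hq.2.2, Loop.mul_ld, Loop.one_mul]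
    have e3 : Loop.rd (y * Loop.ld x p) y = Loop.ld x 1 * a' := by
      rw [← e2 a' ha', ← e1]; exact (Loop.ld_mul _ _).symm
    have e4 : (y * Loop.ld x 1) * p = (Loop.ld x 1 * y) * a := by
      rw [← hp.2.2, ← e2 p hp, ← h2.2.2, e, ha'.2.1, ← e3, Loop.rd_mul]
    exact Sim.trans (Sim.symm ⟨a, h2, e4⟩ |> fun h => h) (by
      exact ⟨p, hp, rfl⟩)
  · simp only [A, B, Prod.snd_mul, Prod.snd_inv]
    rw [comm2 hcc, inv_mul_cancel]

theorem comm (hcc : Loop.IsCC Q) (x y : Q) : Sim (x * y) (y * x) := by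
  have h := comm_aux hcc (Loop.rd 1 x) y
  have e : Loop.ld (Loop.rd 1 x) 1 = x := by
    apply lc (x := Loop.rd 1 x)
    rw [Loop.mul_ld, Loop.rd_mul]
  rwa [e] at h

theorem conj_l (hcc : Loop.IsCC Q) (x y : Q) : ∃ k ∈ N Q, Loop.rd (x * y) x = k * y := by
  obtain ⟨k, hk, e⟩ := (comm hcc x y).left hcc
  exact ⟨k, hk, by apply rc (x := x); rw [Loop.rd_mul, e, hk.1]⟩

theorem conj_r (hcc : Loop.IsCC Q) (x y : Q) : ∃ k ∈ N Q, Loop.ld x (y * x) = k * y := by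
  obtain ⟨k, hk, e⟩ := comm hcc y x
  obtain ⟨k', hk', e'⟩ := norm1 hcc hk y
  exact ⟨k', hk', by apply lc (x := x); rw [Loop.mul_ld, e, ← e', hk.2.2]⟩

theorem assoc (hcc : Loop.IsCC Q) (x y z : Q) : Sim ((x * y) * z) (x * (y * z)) := by
  have sw : ∀ x y z : Q, Sim (x * (y * z)) (y * (x * z)) := by
    intro x y z
    obtain ⟨k, hk, e⟩ := conj_l hcc x y
    rw [hcc.1, e, ← hk.1]
    obtain ⟨m, hm, e'⟩ := norm2 hcc hk (y * (x * z))
    exact ⟨m, hm, e'⟩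
  exact (comm hcc _ _).trans ((sw z x y).trans ((comm hcc z y).mul_left x))

/-- The associator. -/
def f (x y z : Q) : Q := Loop.ld (x * (y * z)) ((x * y) * z)

theorem f_spec (x y z : Q) : (x * y) * z = (x * (y * z)) * f x y z := (Loop.mul_ld _ _).symm

theorem f_uniq {x y z a : Q} (h : (x * y) * z = (x * (y * z)) * a) : f x y z = a := by
  rw [f, h, Loop.ld_mul]

theorem f_nuc (hcc : Loop.IsCC Q) (x y z : Q) : f x y z ∈ N Q := by
  obtain ⟨n, hn, e⟩ := assoc hcc x y z
  rw [f_uniq e]; exact hn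

theorem f1l {n : Q} (hn : n ∈ N Q) (x y z : Q) : f (n * x) y z = f x y z := by
  apply f_uniq
  rw [← hn.1, ← hn.1, f_spec, hn.1, hn.1]

theorem f12 {n : Q} (hn : n ∈ N Q) (x y z : Q) : f (x * n) y z = f x (n * y) z := by
  symm
  apply f_uniq
  rw [hn.2.1, ← hn.1, hn.2.1, ← f_spec]

theorem f23 {n : Q} (hn : n ∈ N Q) (x y z : Q) : f x (y * n) z = f x y (n * z) := by
  symm
  apply f_uniq
  rw [hn.2.1, ← hn.2.2, hn.2.1, ← f_spec]

theorem f1r (hcc : Loop.IsCC Q) {n : Q} (hn : n ∈ N Q) (x y z : Q) :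
    f (x * n) y z = f x y z := by
  obtain ⟨m, hm, e⟩ := norm1 hcc hn x
  rw [e, f1l hm]

theorem f2l (hcc : Loop.IsCC Q) {n : Q} (hn : n ∈ N Q) (x y z : Q) :
    f x (n * y) z = f x y z := by
  rw [← f12 hn, f1r hcc hn]

theorem f2r (hcc : Loop.IsCC Q) {n : Q} (hn : n ∈ N Q) (x y z : Q) :
    f x (y * n) z = f x y z := by
  obtain ⟨m, hm, e⟩ := norm1 hcc hn y
  rw [e, f2l hcc hm]

theorem f3l (hcc : Loop.IsCC Q) {n : Q} (hn : n ∈ N Q) (x y z : Q) :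
    f x y (n * z) = f x y z := by
  rw [← f23 hn, f2r hcc hn]

theorem f_sym12 (hcc : Loop.IsCC Q) (x y z : Q) : f x y z = f y x z := by
  obtain ⟨k, hk, e⟩ := conj_l hcc x y
  rw [← f1l hk y, ← e]
  apply f_uniq
  have := f_spec (Loop.rd (x * y) x) x z
  rw [Loop.rd_mul] at this
  rw [this, hcc.1 x y z]

theorem f_sym23 (hcc : Loop.IsCC Q) (x y z : Q) : f x y z = f x z y := by
  obtain ⟨k, hk, e⟩ := conj_r hcc z y
  rw [← f3l hcc hk x z y, ← e]
  apply f_uniq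
  have := f_spec x z (Loop.ld z (y * z))
  rw [Loop.mul_ld] at this
  rw [← this, hcc.2]

theorem f_comm (hcc : Loop.IsCC Q) (x y z : Q) {n : Q} (hn : n ∈ N Q) :
    f x y z * n = n * f x y z := by
  have h : f x y (z * n) = f x y z := by
    obtain ⟨m, hm, e⟩ := norm1 hcc hn z
    rw [e, f3l hcc hm]
  have h1 := f_spec x y (z * n)
  rw [h, hn.2.2 (x * y) z, f_spec x y z, hn.2.2 y z, hn.2.2 x (y * z),
    ← hn.2.1, ← hn.2.2] at h1
  exact lc h1

variable (Q) in
/-- The centre of the nucleus. -/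
def Z : Type _ := {a : Q // a ∈ N Q ∧ ∀ n ∈ N Q, a * n = n * a}

theorem Z.ext {a b : Z Q} (h : a.1 = b.1) : a = b := Subtype.ext h

instance : Add (Z Q) where
  add a b := ⟨a.1 * b.1, mul_nuc a.2.1 b.2.1, fun n hn => by
    rw [← a.2.1.1, b.2.2 n hn, a.2.1.1, a.2.2 n hn, ← a.2.1.2.1]⟩

instance : Zero (Z Q) where
  zero := ⟨1, one_nuc, fun n _ => by rw [Loop.one_mul, Loop.mul_one]⟩

instance : Neg (Z Q) where
  neg a := ⟨Loop.ld a.1 1, inv_nuc' a.2.1, fun n hn => by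
    apply lc (x := a.1)
    rw [a.2.1.1, a.2.1.1, Loop.mul_ld, Loop.one_mul, a.2.2 n hn, ← a.2.1.2.1, Loop.mul_ld,
      Loop.mul_one]⟩

instance : AddCommGroup (Z Q) where
  add_assoc a b c := Z.ext (a.2.1.1 b.1 c.1).symm
  zero_add a := Z.ext (Loop.one_mul _)
  add_zero a := Z.ext (Loop.mul_one _)
  neg_add_cancel a := Z.ext (inv_left a.2.1)
  add_comm a b := Z.ext (a.2.2 _ b.2.1)
  nsmul := nsmulRec
  zsmul := zsmulRec

theorem Z.add_val (a b : Z Q) : (a + b).1 = a.1 * b.1 := rfl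
theorem Z.zero_val : (0 : Z Q).1 = 1 := rfl

/-- The conjugation action. -/
def C (hcc : Loop.IsCC Q) (a : Z Q) (w : Q) : Z Q :=
  ⟨Loop.ld w (a.1 * w), by
    obtain ⟨m, hm, e⟩ := norm2 hcc a.2.1 w
    rw [e, Loop.ld_mul]
    refine ⟨hm, fun n hn => ?_⟩
    obtain ⟨n', hn', e'⟩ := norm1 hcc hn w
    apply lc (x := w)
    rw [hn.2.2, ← e, ← hn.2.2, e', a.2.1.1, a.2.2 n' hn', ← a.2.1.2.1, e, hm.2.2, ← e',
      hm.2.2]⟩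

theorem C_spec (hcc : Loop.IsCC Q) (a : Z Q) (w : Q) : a.1 * w = w * (C hcc a w).1 :=
  (Loop.mul_ld _ _).symm

/-- The associator in the centre of the nucleus. -/
def F (hcc : Loop.IsCC Q) (x y z : Q) : Z Q :=
  ⟨f x y z, f_nuc hcc x y z, fun _ hn => f_comm hcc x y z hn⟩

theorem pent (hcc : Loop.IsCC Q) (x y z w : Q) :
    C hcc (F hcc x y z) w + F hcc x (y * z) w + F hcc y z w
      = F hcc x y (z * w) + F hcc (x * y) z w := by
  rw [add_comm (C hcc _ _), add_right_comm, add_comm (F hcc x (y * z) w)]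
  apply Z.ext
  simp only [Z.add_val]
  have h1 : ((x * y) * z) * w = (x * (y * (z * w))) * (f x y (z * w) * f (x * y) z w) := by
    rw [f_spec (x * y) z w, f_spec x y (z * w), ← (f_nuc hcc _ _ _).2.1]
  have h2 : ((x * y) * z) * w = (x * (y * (z * w))) *
      (f y z w * f x (y * z) w * (C hcc (F hcc x y z) w).1) := by
    rw [f_spec x y z, ← (f_nuc hcc x y z).2.1]
    have := C_spec hcc (F hcc x y z) w
    simp only [F] at this ⊢
    rw [this]
    have hC := (C hcc (F hcc x y z) w).2.1
    simp only [F] at hC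
    rw [hC.2.2, hC.2.2, f_spec x (y * z) w, f_spec y z w, (f_nuc hcc y z w).2.2,
      (f_nuc hcc x (y * z) w).2.2]
  exact lc (h2.symm.trans h1)

theorem F12 (hcc : Loop.IsCC Q) (x y z : Q) : F hcc x y z = F hcc y x z :=
  Z.ext (f_sym12 hcc x y z)
theorem F23 (hcc : Loop.IsCC Q) (x y z : Q) : F hcc x y z = F hcc x z y :=
  Z.ext (f_sym23 hcc x y z)
theorem Fc (hcc : Loop.IsCC Q) (x y z w : Q) : F hcc (x * y) z w = F hcc (y * x) z w := by
  obtain ⟨n, hn, e⟩ := comm hcc x y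
  apply Z.ext
  change f _ _ _ = f _ _ _
  rw [e, f1r hcc hn]

theorem cross (hcc : Loop.IsCC Q) (x y z w : Q) :
    F hcc (x * y) z w = C hcc (F hcc x z w) y + F hcc y z w := by
  have E1 := pent hcc x z w y
  have E3 := pent hcc z x w y
  have E4 := pent hcc z w x y
  have r : ∀ a b c, F hcc a b c = F hcc c a b := fun a b c => by rw [F23, F12]
  rw [F12 hcc x (z * w) y, r x z (w * y)] at E1
  rw [F12 hcc z x w, F12 hcc z (x * w) y, r z x (w * y), Fc hcc z x, F23 hcc (w * y) z x] at E3
  rw [r z w x, F12 hcc z (w * x) y, r z w (x * y), Fc hcc w x, F12 hcc w x y] at E4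
  rw [← r z w y]
  clear r
  grind

theorem C_zero (hcc : Loop.IsCC Q) (w : Q) : C hcc 0 w = 0 := by
  apply Z.ext
  apply lc (x := w)
  rw [← C_spec, Z.zero_val, Loop.one_mul, Loop.mul_one]

theorem C_inj (hcc : Loop.IsCC Q) {a : Z Q} {w : Q} (h : C hcc a w = 0) : a = 0 := by
  apply Z.ext
  apply rc (x := w)
  rw [C_spec hcc, h, Z.zero_val, Loop.one_mul, Loop.mul_one]

theorem F_zero (hcc : Loop.IsCC Q) (x y z : Q) :
    F hcc x y z = 0 ↔ x * (y * z) = (x * y) * z := by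
  constructor
  · intro h
    have h' : f x y z = 1 := congrArg Subtype.val h
    rw [f_spec, h', Loop.mul_one]
  · intro h
    apply Z.ext
    exact f_uniq (by rw [Z.zero_val, Loop.mul_one, h])

theorem F_one (hcc : Loop.IsCC Q) (y z : Q) : F hcc 1 y z = 0 := by
  rw [F_zero, Loop.one_mul, Loop.one_mul]

theorem F_sub (hcc : Loop.IsCC Q) (y z : Q) : Loop.IsSubloop {x | F hcc x y z = 0} := by
  have hmul : ∀ a b, F hcc a y z = 0 → F hcc (a * b) y z = F hcc b y z := by
    intro a b h
    rw [cross, h, C_zero, zero_add]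
  refine ⟨F_one hcc y z, fun a ha b hb => ?_, fun a ha b hb => ?_, fun a ha b hb => ?_⟩
  · exact (hmul a b ha).trans hb
  · have := hmul a (Loop.ld a b) ha
    rw [Loop.mul_ld] at this
    exact this.symm.trans hb
  · have := cross hcc (Loop.rd a b) b y z
    have ha' : F hcc a y z = 0 := ha
    have hb' : F hcc b y z = 0 := hb
    rw [Loop.rd_mul, ha', hb', add_zero] at this
    exact C_inj hcc this.symm

theorem F_closure (hcc : Loop.IsCC Q) {S : Set Q} {y z : Q} (h : ∀ x ∈ S, F hcc x y z = 0) :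
    ∀ x ∈ Loop.closure S, F hcc x y z = 0 :=
  fun _ hx => hx _ ⟨F_sub hcc y z, h⟩

theorem F_rot (hcc : Loop.IsCC Q) (a b c : Q) : F hcc a b c = F hcc c a b := by
  rw [F23, F12]

theorem F_closure3 (hcc : Loop.IsCC Q) {S : Set Q}
    (h : ∀ x ∈ S, ∀ y ∈ S, ∀ z ∈ S, F hcc x y z = 0) :
    ∀ x ∈ Loop.closure S, ∀ y ∈ Loop.closure S, ∀ z ∈ Loop.closure S, F hcc x y z = 0 := by
  have h1 : ∀ x ∈ Loop.closure S, ∀ y ∈ S, ∀ z ∈ S, F hcc x y z = 0 :=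
    fun x hx y hy z hz => F_closure hcc (fun x hx => h x hx y hy z hz) x hx
  have h2 : ∀ x ∈ Loop.closure S, ∀ y ∈ Loop.closure S, ∀ z ∈ S, F hcc x y z = 0 :=
    fun x hx y hy z hz => by
      rw [F12]
      exact F_closure hcc (fun y hy => by rw [F12]; exact h1 x hx y hy z hz) y hy
  intro x hx y hy z hz
  rw [F_rot]
  exact F_closure hcc (fun z hz => by rw [← F_rot]; exact h2 x hx y hy z hz) z hz

theorem mem_closure {S : Set Q} {x : Q} (h : x ∈ S) : x ∈ Loop.closure S :=
  fun _ hT => hT.2 h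

theorem E_iff (hcc : Loop.IsCC Q) (b c : Q) :
    (c * b) * Loop.ld b 1 = c ↔ F hcc b b c = 0 := by
  have h0 : (c * b) * Loop.ld b 1 = c ↔ F hcc c b (Loop.ld b 1) = 0 := by
    rw [F_zero, Loop.mul_ld, Loop.mul_one, eq_comm]
  have h1 := cross hcc b (Loop.ld b 1) b c
  rw [Loop.mul_ld, F_one] at h1
  rw [h0, F_rot, F23]
  constructor
  · intro h
    rw [h, add_zero] at h1
    exact C_inj hcc h1.symm
  · intro h
    rw [h, C_zero, zero_add] at h1
    exact h1.symm

end LoopAux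

open Loop

/-- In a CC-loop with `b`, `c` power-associative, `⟨b,c⟩` is a group iff
`c E_b = c` and `b E_c = b`; if moreover `c` is WIP, the two conditions
are equivalent. -/
theorem stmt_13 {Q : Type*} [Loop Q] (hcc : IsCC Q) (b c : Q)
    (hb : IsPA b) (hc : IsPA c) :
    ((∀ x ∈ closure {b, c}, ∀ y ∈ closure {b, c}, ∀ z ∈ closure {b, c},
        x * (y * z) = (x * y) * z) ↔
      ((c * b) * ld b 1 = c ∧ (b * c) * ld c 1 = b)) ∧
    (IsWIP c → (((c * b) * ld b 1 = c) ↔ ((b * c) * ld c 1 = b))) := by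
  have hb0 : LoopAux.F hcc b b b = 0 :=
    (LoopAux.F_zero hcc _ _ _).2 (hb b (LoopAux.mem_closure rfl) b (LoopAux.mem_closure rfl)
      b (LoopAux.mem_closure rfl))
  have hc0 : LoopAux.F hcc c c c = 0 :=
    (LoopAux.F_zero hcc _ _ _).2 (hc c (LoopAux.mem_closure rfl) c (LoopAux.mem_closure rfl)
      c (LoopAux.mem_closure rfl))
  rw [LoopAux.E_iff hcc b c, LoopAux.E_iff hcc c b]
  have hbm : b ∈ closure {b, c} := LoopAux.mem_closure (by simp)
  have hcm : c ∈ closure {b, c} := LoopAux.mem_closure (by simp)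
  refine ⟨⟨fun h => ?_, fun h => ?_⟩, fun hw => ?_⟩
  · exact ⟨(LoopAux.F_zero hcc _ _ _).2 (h b hbm b hbm c hcm),
      (LoopAux.F_zero hcc _ _ _).2 (h c hcm c hcm b hbm)⟩
  · obtain ⟨h1, h2⟩ := h
    intro x hx y hy z hz
    rw [← LoopAux.F_zero hcc]
    refine LoopAux.F_closure3 hcc ?_ x hx y hy z hz
    have h3 : LoopAux.F hcc b c b = 0 := by rw [LoopAux.F23, h1]
    have h4 : LoopAux.F hcc c b b = 0 := by rw [LoopAux.F12, h3]
    have h5 : LoopAux.F hcc c b c = 0 := by rw [LoopAux.F23, h2]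
    have h6 : LoopAux.F hcc b c c = 0 := by rw [LoopAux.F12, h5]
    rintro x (rfl | rfl) y (rfl | rfl) z (rfl | rfl) <;> assumption
  · have h1 : LoopAux.F hcc b c (ld (b * c) 1) = 0 := by
      rw [LoopAux.F_zero, hw, mul_ld, mul_ld]
    rw [LoopAux.F_rot] at h1
    have h2 : LoopAux.F hcc (b * c) b c = 0 := by
      have := (LoopAux.F_sub hcc b c).2.2.2 1 (LoopAux.F_one hcc b c) _ h1
      have e : rd 1 (ld (b * c) 1) = b * c := by
        apply LoopAux.rc (x := ld (b * c) 1)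
        rw [rd_mul, mul_ld]
      rwa [e] at this
    rw [LoopAux.cross] at h2
    constructor
    · intro h
      rw [h, LoopAux.C_zero, zero_add] at h2
      rw [LoopAux.F23, h2]
    · intro h
      rw [LoopAux.F23] at h
      rw [h, add_zero] at h2
      exact LoopAux.C_inj hcc h2
end

section
/- In a CC-loop, if c is a WIP element and b and c are power-associative elements, then the subloop ⟨b, c²⟩ generated by {b, c·c} is a group: x·(y·z) = (x·y)·z for all x, y, z in ⟨b, c·c⟩. -/
namespace Loop

section aux
variable {Q : Type*} [Loop Q]

theorem lcancel {x y z : Q} (h : x * y = x * z) : y = z := by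
  rw [← ld_mul x y, h, ld_mul]

theorem rcancel {x y z : Q} (h : y * x = z * x) : y = z := by
  rw [← mul_rd y x, h, mul_rd]

def LP (x : Q) : Equiv.Perm Q := ⟨fun y => x * y, fun y => ld x y, ld_mul x, mul_ld x⟩
def RP (x : Q) : Equiv.Perm Q :=
  ⟨fun y => y * x, fun y => rd y x, fun y => mul_rd y x, fun y => rd_mul y x⟩

@[simp] theorem LP_apply (x y : Q) : LP x y = x * y := rfl
@[simp] theorem RP_apply (x y : Q) : RP x y = y * x := rfl
@[simp] theorem LP_inv_apply (x y : Q) : (LP x)⁻¹ y = ld x y := rfl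
@[simp] theorem RP_inv_apply (x y : Q) : (RP x)⁻¹ y = rd y x := rfl

def TP (x : Q) : Equiv.Perm Q := (LP x)⁻¹ * RP x

theorem TP_apply (x y : Q) : TP x y = ld x (y * x) := rfl
theorem TP_inv_apply (x y : Q) : (TP x)⁻¹ y = rd (x * y) x := by
  rfl

/-- autotopism group -/
def Atp (Q : Type*) [Loop Q] : Subgroup (Equiv.Perm Q × Equiv.Perm Q × Equiv.Perm Q) where
  carrier := {g | ∀ y z, g.1 y * g.2.1 z = g.2.2 (y * z)}
  one_mem' := by intro y z; rfl
  mul_mem' := by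
    intro g h hg hh y z
    change g.1 (h.1 y) * g.2.1 (h.2.1 z) = g.2.2 (h.2.2 (y * z))
    rw [hg, hh]
  inv_mem' := by
    intro g hg y z
    change g.1⁻¹ y * g.2.1⁻¹ z = g.2.2⁻¹ (y * z)
    rw [Equiv.Perm.eq_inv_iff_eq, ← hg]
    simp

def p1 : Atp Q →* Equiv.Perm Q := (MonoidHom.fst _ _).comp (Atp Q).subtype
def p2 : Atp Q →* Equiv.Perm Q :=
  ((MonoidHom.fst _ _).comp (MonoidHom.snd _ _)).comp (Atp Q).subtype
def p3 : Atp Q →* Equiv.Perm Q :=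
  ((MonoidHom.snd _ _).comp (MonoidHom.snd _ _)).comp (Atp Q).subtype

theorem atp (g : Atp Q) (y z : Q) : p1 g y * p2 g z = p3 g (y * z) := g.2 y z

def mkA (A B C : Equiv.Perm Q) (h : ∀ y z, A y * B z = C (y * z)) : Atp Q := ⟨(A, B, C), h⟩
@[simp] theorem p1_mk (A B C : Equiv.Perm Q) (h) : p1 (mkA A B C h) = A := rfl
@[simp] theorem p2_mk (A B C : Equiv.Perm Q) (h) : p2 (mkA A B C h) = B := rfl
@[simp] theorem p3_mk (A B C : Equiv.Perm Q) (h) : p3 (mkA A B C h) = C := rfl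

def KK (Q : Type*) [Loop Q] : Subgroup (Atp Q) := (p1.ker ⊔ p2.ker) ⊔ p3.ker

instance : (KK Q).Normal := by unfold KK; infer_instance

theorem KK_decomp {g : Atp Q} (h : g ∈ KK Q) :
    ∃ k1 k2 k3 : Atp Q, p1 k1 = 1 ∧ p2 k2 = 1 ∧ p3 k3 = 1 ∧ k1 * k2 * k3 = g := by
  unfold KK at h
  rw [Subgroup.mem_sup_of_normal_right] at h
  obtain ⟨u, hu, k3, h3, rfl⟩ := h
  rw [Subgroup.mem_sup_of_normal_right] at hu
  obtain ⟨k1, h1, k2, h2, rfl⟩ := hu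
  exact ⟨k1, k2, k3, h1, h2, h3, rfl⟩

theorem k1_mem {g : Atp Q} (h : p1 g = 1) : g ∈ KK Q :=
  (le_sup_left.trans le_sup_left : p1.ker ≤ KK Q) h
theorem k2_mem {g : Atp Q} (h : p2 g = 1) : g ∈ KK Q :=
  (le_sup_right.trans le_sup_left : p2.ker ≤ KK Q) h
theorem k3_mem {g : Atp Q} (h : p3 g = 1) : g ∈ KK Q :=
  (le_sup_right : p3.ker ≤ KK Q) h

theorem nuc_of_left (hcc : IsCC Q) {n : Q} (h : ∀ x y : Q, n * (x * y) = (n * x) * y) :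
    n ∈ nucleus Q := by
  have hm : ∀ x y : Q, x * (n * y) = (x * n) * y := by
    intro x y
    have := hcc.1 n (ld n (x * n)) y
    rw [mul_ld, mul_rd, h, mul_ld] at this
    exact this.symm
  refine ⟨h, hm, ?_⟩
  intro x y
  have := hcc.2 n y x
  rw [this, ← hm, mul_ld]

theorem nuc_of_right (hcc : IsCC Q) {n : Q} (h : ∀ x y : Q, x * (y * n) = (x * y) * n) :
    n ∈ nucleus Q := by
  have hm : ∀ x y : Q, x * (n * y) = (x * n) * y := by
    intro x y
    have := hcc.2 n (rd (n * y) n) x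
    rw [rd_mul, ld_mul, ← h, rd_mul] at this
    exact this
  refine ⟨?_, hm, h⟩
  intro x y
  have := hcc.1 n x y
  rw [this, hm, rd_mul]

theorem nuc_of_mid (hcc : IsCC Q) {n : Q} (hm : ∀ x y : Q, x * (n * y) = (x * n) * y) :
    n ∈ nucleus Q := by
  apply nuc_of_left hcc
  intro x y
  have := hcc.1 n x y
  rw [this, hm, rd_mul]

theorem k1_form (hcc : IsCC Q) {g : Atp Q} (h : p1 g = 1) :
    ∃ n ∈ nucleus Q, p2 g = RP n ∧ p3 g = RP n := by
  have e : ∀ y z, y * p2 g z = p3 g (y * z) := by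
    intro y z; rw [← atp, h]; rfl
  have e1 : ∀ z, p2 g z = p3 g z := by
    intro z; have := e 1 z; rwa [one_mul, one_mul] at this
  have e2 : ∀ z, p3 g z = z * p3 g 1 := by
    intro z; have := e z 1; rw [mul_one, e1] at this; exact this.symm
  refine ⟨p3 g 1, ?_, ?_, ?_⟩
  · apply nuc_of_right hcc
    intro x y
    rw [← e2, ← e2, ← e, e1]
  · ext z; rw [e1, e2]; rfl
  · ext z; rw [e2]; rfl

theorem k2_form (hcc : IsCC Q) {g : Atp Q} (h : p2 g = 1) :
    ∃ n ∈ nucleus Q, p1 g = LP n ∧ p3 g = LP n := by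
  have e : ∀ y z, p1 g y * z = p3 g (y * z) := by
    intro y z; rw [← atp, h]; rfl
  have e1 : ∀ z, p1 g z = p3 g z := by
    intro z; have := e z 1; rwa [mul_one, mul_one] at this
  have e2 : ∀ z, p3 g z = p3 g 1 * z := by
    intro z; have := e 1 z; rw [one_mul, e1] at this; exact this.symm
  refine ⟨p3 g 1, ?_, ?_, ?_⟩
  · apply nuc_of_left hcc
    intro x y
    rw [← e2, ← e2, ← e, e1]
  · ext z; rw [e1, e2]; rfl
  · ext z; rw [e2]; rfl

theorem k3_form (hcc : IsCC Q) {g : Atp Q} (h : p3 g = 1) :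
    ∃ n ∈ nucleus Q, p2 g = LP n := by
  have e : ∀ y z, p1 g y * p2 g z = y * z := by
    intro y z; rw [atp, h]; rfl
  have e1 : ∀ y, p1 g y * p2 g 1 = y := by
    intro y; rw [e, mul_one]
  have e1' : ∀ y, p1 g (y * p2 g 1) = y := by
    intro y; apply rcancel (x := p2 g 1); rw [e1]
  have e2 : ∀ z, p2 g z = p2 g 1 * z := by
    intro z
    have h1 := e (1 * p2 g 1) z
    rw [e1', one_mul, one_mul] at h1
    exact h1
  refine ⟨p2 g 1, ?_, ?_⟩
  · apply nuc_of_mid hcc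
    intro x y
    have := e (x * p2 g 1) y
    rw [e1'] at this
    rw [← e2]; exact this
  · ext z; rw [e2]; rfl

theorem KK_p3 (hcc : IsCC Q) {g : Atp Q} (h : g ∈ KK Q) :
    ∃ n ∈ nucleus Q, ∃ m ∈ nucleus Q, p3 g = RP n * LP m := by
  obtain ⟨k1, k2, k3, h1, h2, h3, rfl⟩ := KK_decomp h
  obtain ⟨n, hn, -, hn'⟩ := k1_form hcc h1
  obtain ⟨m, hm, -, hm'⟩ := k2_form hcc h2
  exact ⟨n, hn, m, hm, by rw [map_mul, map_mul, hn', hm', h3, _root_.mul_one]⟩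

theorem KK_shift (hcc : IsCC Q) {g g' : Atp Q} (h : g ∈ KK Q) (e : p3 g' = p2 g) :
    g' ∈ KK Q := by
  obtain ⟨k1, k2, k3, h1, h2, h3, rfl⟩ := KK_decomp h
  obtain ⟨n, hn, hn', hn''⟩ := k1_form hcc h1
  obtain ⟨m, hm, hm'⟩ := k3_form hcc h3
  let k : Atp Q := mkA (LP m) 1 (LP m) (fun y z => (hm.1 y z).symm)
  have hk : k ∈ KK Q := k2_mem rfl
  have : g' * (k1 * k)⁻¹ ∈ KK Q := by
    apply k3_mem
    rw [map_mul, e, map_inv, mul_inv_eq_one, map_mul, map_mul, map_mul, h2, _root_.mul_one, hn',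
      hn'', hm']
    rfl
  have h3 := (KK Q).mul_mem this ((KK Q).mul_mem (k1_mem h1) hk)
  rwa [inv_mul_cancel_right] at h3

def al (hcc : IsCC Q) (x : Q) : Atp Q := mkA (TP x)⁻¹ (LP x) (LP x) (by
  intro y z; rw [TP_inv_apply]; exact (hcc.1 x y z).symm)
def be (hcc : IsCC Q) (x : Q) : Atp Q := mkA (RP x) (TP x) (RP x) (by
  intro y z; exact (hcc.2 x z y).symm)

/-- the automorphism ℓ(x,y) -/
def l (x y z : Q) : Q := ld (x * y) (x * (y * z))

theorem l_spec (x y z : Q) : (x * y) * l x y z = x * (y * z) := mul_ld _ _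

theorem l_one (x y : Q) : l x y 1 = 1 := by
  apply lcancel (x := x * y); rw [l_spec, mul_one, mul_one]

theorem l_aux (hcc : IsCC Q) (x y z : Q) :
    l x y z = TP (x * y) ((TP x)⁻¹ ((TP y)⁻¹ z)) ∧ ∀ w, l x y (z * w) = l x y z * l x y w := by
  have key : ∀ w, l x y (z * w) = TP (x * y) ((TP x)⁻¹ ((TP y)⁻¹ z)) * l x y w := by
    intro w
    apply lcancel (x := x * y)
    rw [l_spec, hcc.1 y z w, hcc.1 x _ _, hcc.1 (x * y), l_spec, TP_inv_apply, TP_inv_apply,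
      TP_apply, mul_ld, mul_rd]
  have k1 := key 1
  rw [mul_one, l_one, mul_one] at k1
  exact ⟨k1, fun w => by rw [key, k1]⟩

theorem l_mul (hcc : IsCC Q) (x y z w : Q) : l x y (z * w) = l x y z * l x y w :=
  (l_aux hcc x y z).2 w

theorem T_rel (hcc : IsCC Q) (x y : Q) :
    TP (x * y) * (TP x)⁻¹ * (TP y)⁻¹ = (LP (x * y))⁻¹ * LP x * LP y := by
  ext z
  exact (l_aux hcc x y z).1.symm

theorem grp_aux {H : Type*} [Group H] {ax ay axy bx bxy by' : H}
    (h1 : bxy * bx⁻¹ * by'⁻¹ = axy⁻¹ * ax * ay)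
    (h2 : (axy⁻¹ * bxy) * (ax⁻¹ * bx)⁻¹ * (ay⁻¹ * by')⁻¹ = axy⁻¹ * ax * ay) :
    by' * ax * by'⁻¹ = ay⁻¹ * ax⁻¹ * axy * ax := by
  have e1 : bxy = axy⁻¹ * ax * ay * by' * bx := by rw [← h1]; group
  -- h2 : axy⁻¹ bxy bx⁻¹ ax by⁻¹ ay = axy⁻¹ ax ay
  have e2 : bxy * bx⁻¹ * ax * by'⁻¹ = ax := by
    have := congrArg (fun t => axy * t * ay⁻¹) h2
    simp only [mul_inv_rev, inv_inv] at this
    group at this ⊢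
    exact this
  rw [e1] at e2
  have := congrArg (fun t => ay⁻¹ * ax⁻¹ * axy * t) e2
  group at this ⊢
  exact this

theorem comm_KK (hcc : IsCC Q) (x y : Q) :
    al hcc x * al hcc y * (al hcc x)⁻¹ * (al hcc y)⁻¹ ∈ KK Q := by
  let π := QuotientGroup.mk' (KK Q)
  have hπ : ∀ g, π g = 1 ↔ g ∈ KK Q := fun g => QuotientGroup.eq_one_iff g
  have rel : ∀ g h, π g = π h ↔ g * h⁻¹ ∈ KK Q := by
    intro g h; rw [← hπ, map_mul, map_inv, mul_inv_eq_one]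
  let a := al hcc
  let b := be hcc
  have h1 : ∀ x y, π (b (x*y) * (b x)⁻¹ * (b y)⁻¹) = π ((a (x*y))⁻¹ * a x * a y) := by
    intro x y
    rw [rel]; apply k2_mem
    rw [map_mul, map_inv, mul_inv_eq_one]
    exact T_rel hcc x y
  have h2 : ∀ x y, π (((a (x*y))⁻¹ * b (x*y)) * ((a x)⁻¹ * b x)⁻¹ * ((a y)⁻¹ * b y)⁻¹)
      = π ((a (x*y))⁻¹ * a x * a y) := by
    intro x y
    have := h1 x y
    rw [rel] at this ⊢
    exact KK_shift hcc this rfl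
  have h3 : ∀ x y, π (b y * a x * (b y)⁻¹) = π ((a y)⁻¹ * (a x)⁻¹ * a (x*y) * a x) := by
    intro x y
    have e1 := h1 x y
    have e2 := h2 x y
    simp only [map_mul, map_inv] at e1 e2 ⊢
    exact grp_aux e1 e2
  have h4 : ∀ x y, π (((a y)⁻¹ * b y) * a x * ((a y)⁻¹ * b y)⁻¹)
      = π ((a y)⁻¹ * (a x)⁻¹ * a (x*y) * a x) := by
    intro x y
    have := h3 x y
    rw [rel] at this ⊢
    exact KK_shift hcc this rfl
  have h5 : ∀ x y, π (a y) * (π (a x)⁻¹ * π (a (x*y)) * π (a x))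
      = (π (a x)⁻¹ * π (a (x*y)) * π (a x)) * π (a y) := by
    intro x y
    have e1 := h3 x y
    have e2 := h4 x y
    simp only [map_mul, map_inv] at e1 e2 ⊢
    have e3 : (π (a y))⁻¹ * (π (b y) * π (a x) * (π (b y))⁻¹) * π (a y)
      = (π (a y))⁻¹ * (π (a x))⁻¹ * π (a (x*y)) * π (a x) := by
      rw [← e2]; group
    rw [e1] at e3
    have := congrArg (fun t => π (a y) * π (a y) * t) e3
    group at this ⊢
    exact this.symm
  have h6 : ∀ x y, π (a x) * π (a y) * (π (a x))⁻¹ = π (a (rd (x * y) x)) := by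
    intro x y
    rw [← map_mul, ← map_inv, ← map_mul, rel]
    apply k3_mem
    rw [map_mul, map_inv, mul_inv_eq_one, map_mul, map_mul, map_inv]
    change LP x * LP y * (LP x)⁻¹ = LP (rd (x * y) x)
    rw [mul_inv_eq_iff_eq_mul]
    ext z
    exact hcc.1 x y z
  have h7 : ∀ w x, π (a w) * π (a (w * x)) = π (a (w * x)) * π (a w) := by
    intro w x
    have e := h5 x (ld x (w * x))
    have e' := h6 x (ld x (w * x))
    rw [mul_ld] at e e'
    rw [mul_rd] at e'
    rw [← e']
    have := congrArg (fun t => π (a x) * t * (π (a x))⁻¹) e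
    simp only [map_inv] at this
    group at this ⊢
    exact this
  have h8 : π (a x) * π (a y) = π (a y) * π (a x) := by
    have := h7 x (ld x y)
    rwa [mul_ld] at this
  rw [← hπ, map_mul, map_mul, map_mul, map_inv, map_inv, h8]
  have : π (a y) * π (a x) * (π (a x))⁻¹ * (π (a y))⁻¹ = 1 := by group
  exact this

theorem basarab0 (hcc : IsCC Q) (x y : Q) :
    ∃ n ∈ nucleus Q, ∃ m ∈ nucleus Q, ∀ z, x * (y * z) = (m * (y * (x * z))) * n := by
  obtain ⟨n, hn, m, hm, e⟩ := KK_p3 hcc (comm_KK hcc x y)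
  refine ⟨n, hn, m, hm, fun z => ?_⟩
  have e' : LP x * LP y = RP n * LP m * (LP y * LP x) := by
    rw [← e, map_mul, map_mul, map_mul, map_inv, map_inv]
    change _ = LP x * LP y * (LP x)⁻¹ * (LP y)⁻¹ * (LP y * LP x)
    group
  exact congrArg (fun f : Equiv.Perm Q => f z) e'

theorem nuc_mul {n m : Q} (hn : n ∈ nucleus Q) (hm : m ∈ nucleus Q) : n * m ∈ nucleus Q := by
  refine ⟨fun x y => ?_, fun x y => ?_, fun x y => ?_⟩
  · rw [← hn.1, hm.1, hn.1, hn.1]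
  · rw [← hn.1, hn.2.1, hm.2.1, ← hn.2.1]
  · rw [hm.2.2, hm.2.2, hn.2.2, hm.2.2]

theorem nuc_conjL (hcc : IsCC Q) {n : Q} (hn : n ∈ nucleus Q) (x : Q) :
    ∃ m ∈ nucleus Q, x * n = m * x := by
  refine ⟨rd (x * n) x, ?_, (rd_mul _ _).symm⟩
  apply nuc_of_left hcc
  have key : ∀ y v, rd (x * n) x * (y * (x * v)) = rd (x * (n * ld x (y * x))) x * (x * v) := by
    intro y v
    have h := hcc.1 x (ld x (y * x)) v
    rw [mul_ld, mul_rd] at h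
    rw [← h, ← hcc.1, hn.1, ← hcc.1]
  intro y z
  have h1 := key y (ld x 1)
  have h2 := key y (ld x z)
  rw [mul_ld] at h1 h2
  rw [mul_one, mul_one] at h1
  rw [h2, h1]

theorem nuc_conjR (hcc : IsCC Q) {n : Q} (hn : n ∈ nucleus Q) (x : Q) :
    ∃ m ∈ nucleus Q, n * x = x * m := by
  refine ⟨ld x (n * x), ?_, (mul_ld _ _).symm⟩
  apply nuc_of_right hcc
  have key : ∀ y v, ((v * x) * y) * ld x (n * x) = (v * x) * ld x ((rd (x * y) x * n) * x) := by
    intro y v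
    have h := hcc.2 x (rd (x * y) x) v
    rw [rd_mul, ld_mul] at h
    rw [← h, ← hcc.2, ← hn.2.2, ← hcc.2]
  intro z y
  have h1 := key y (rd 1 x)
  have h2 := key y (rd z x)
  rw [rd_mul] at h1 h2
  rw [one_mul, one_mul] at h1
  rw [h2, h1]

theorem nuc_inv (hcc : IsCC Q) {n : Q} (hn : n ∈ nucleus Q) :
    ∃ m ∈ nucleus Q, n * m = 1 ∧ m * n = 1 := by
  have e : n * ld n 1 = 1 := mul_ld _ _
  have e' : ld n 1 * n = 1 := by
    apply lcancel (x := n)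
    rw [hn.1, e, one_mul, mul_one]
  refine ⟨ld n 1, ?_, e, e'⟩
  apply nuc_of_left hcc
  intro x y
  apply lcancel (x := n)
  rw [hn.1, e, one_mul, hn.1, hn.1, e, one_mul]

/-- equivalence modulo the nucleus -/
def Eqv (u v : Q) : Prop := ∃ k ∈ nucleus Q, u = v * k

theorem Eqv.symm (hcc : IsCC Q) {u v : Q} (h : Eqv u v) : Eqv v u := by
  obtain ⟨k, hk, rfl⟩ := h
  obtain ⟨m, hm, e, -⟩ := nuc_inv hcc hk
  exact ⟨m, hm, by rw [← hk.2.1, e, mul_one]⟩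

theorem Eqv.trans {u v w : Q} (h : Eqv u v) (h' : Eqv v w) : Eqv u w := by
  obtain ⟨k, hk, rfl⟩ := h
  obtain ⟨m, hm, rfl⟩ := h'
  exact ⟨m * k, nuc_mul hm hk, by rw [← hm.2.1]⟩

theorem Eqv.mul_left {u v : Q} (h : Eqv u v) (w : Q) : Eqv (w * u) (w * v) := by
  obtain ⟨k, hk, rfl⟩ := h
  exact ⟨k, hk, by rw [hk.2.2]⟩

theorem basarab1 (hcc : IsCC Q) (x y z : Q) : Eqv (x * (y * z)) (y * (x * z)) := by
  obtain ⟨n, hn, m, hm, e⟩ := basarab0 hcc x y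
  obtain ⟨m', hm', e'⟩ := nuc_conjR hcc hm (y * (x * z))
  exact ⟨m' * n, nuc_mul hm' hn, by rw [e, e', ← hm'.2.1]⟩

theorem basarab2 (hcc : IsCC Q) (x y : Q) : Eqv (x * y) (y * x) := by
  have := basarab1 hcc x y 1
  rwa [mul_one, mul_one] at this

theorem basarab3 (hcc : IsCC Q) (x y z : Q) : Eqv (x * (y * z)) ((x * y) * z) :=
  Eqv.symm hcc <| (basarab2 hcc (x * y) z).trans <| (basarab1 hcc z x y).trans <|
    (basarab2 hcc z y).mul_left x

/-- the associator -/
def As (x y z : Q) : Q := ld z (l x y z)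

theorem As_spec (x y z : Q) : l x y z = z * As x y z := (mul_ld _ _).symm

theorem As_mem (hcc : IsCC Q) (x y z : Q) : As x y z ∈ nucleus Q := by
  obtain ⟨k, hk, e⟩ := basarab3 hcc x y z
  have : As x y z = k := by
    apply lcancel (x := z); rw [← As_spec]
    apply lcancel (x := x * y); rw [l_spec, hk.2.2, e]
  rwa [this]

theorem l_nuc {n : Q} (hn : n ∈ nucleus Q) (x y : Q) : l x y n = n := by
  apply lcancel (x := x * y); rw [l_spec, hn.2.2]

theorem As_comm (hcc : IsCC Q) (x y z : Q) {n : Q} (hn : n ∈ nucleus Q) :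
    n * As x y z = As x y z * n := by
  have hA := As_mem hcc x y z
  obtain ⟨m, hm, e⟩ := nuc_conjL hcc hn z
  have h1 := l_mul hcc x y z n
  have h2 := l_mul hcc x y m z
  rw [← e, h1, l_nuc hn, l_nuc hm, As_spec, ← hA.2.1, hm.1, ← e, ← hn.2.1] at h2
  exact (lcancel h2).symm

theorem l_eqv (hcc : IsCC Q) (x y z k : Q) (hk : k ∈ nucleus Q) :
    l (y * k) x z = l y x z := by
  obtain ⟨m, hm, e⟩ := nuc_conjR hcc hk x
  apply lcancel (x := (y * k) * x)
  rw [l_spec, ← hk.2.1, ← hk.2.1, hk.1, e, ← hm.2.1, ← l_spec y x (m * z), l_mul hcc, l_nuc hm,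
    hm.2.1, hm.2.2]

theorem As_sym12 (hcc : IsCC Q) (x y z : Q) : As x y z = As y x z := by
  obtain ⟨k, hk, e⟩ := basarab2 hcc x y
  have e2 : x * y = rd (x * y) x * x := (rd_mul _ _).symm
  obtain ⟨m, hm, e3⟩ := nuc_conjL hcc hk x
  -- x * y = (y * x) * k = y * (m * x)
  have e4 : rd (x * y) x = y * m := by
    apply rcancel (x := x)
    rw [rd_mul, e, ← hk.2.2, e3, hm.2.1]
  have h : l x y z = l (rd (x * y) x) x z := by
    apply lcancel (x := x * y)
    rw [l_spec, hcc.1]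
    conv_rhs => rw [e2]
    rw [← e2, ← l_spec (rd (x * y) x) x z, ← e2]
  unfold As
  rw [h, e4, l_eqv hcc x y z m hm]

theorem As_sym23 (hcc : IsCC Q) (x y z : Q) : As x y z = As x z y := by
  obtain ⟨k, hk, e⟩ := basarab2 hcc y z
  -- y'' = z \ (y z)
  obtain ⟨m, hm, e3⟩ := (⟨k, hk, rfl⟩ : ∃ m ∈ nucleus Q, m = k)
  have e4 : ld z (y * z) = y * k := by
    apply lcancel (x := z)
    rw [mul_ld, e, hk.2.2]
  have hA := As_mem hcc x y z
  have hB := As_mem hcc x z y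
  have h1 : x * (y * z) = ((x * y) * z) * As x y z := by
    rw [← l_spec, As_spec, hA.2.2]
  have h2 : x * (z * (y * k)) = ((x * z) * (y * k)) * As x z y := by
    rw [← l_spec, l_mul hcc, l_nuc hk, As_spec, ← hB.2.1, ← As_comm hcc x z y hk,
      ← hB.2.2, ← hB.2.2]
  rw [← e4, mul_ld, ← hcc.2 z y x, h1] at h2
  exact lcancel h2

theorem As_eq_one {x y z : Q} : As x y z = 1 ↔ l x y z = z := by
  constructor
  · intro h; rw [As_spec, h, mul_one]
  · intro h; apply lcancel (x := z); rw [← As_spec, h, mul_one]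

theorem l_sub (hcc : IsCC Q) (x y : Q) : IsSubloop {z : Q | As x y z = 1} := by
  refine ⟨As_eq_one.2 (l_one x y), ?_, ?_, ?_⟩
  · intro a ha b hb
    simp only [Set.mem_setOf_eq, As_eq_one] at *
    rw [l_mul hcc, ha, hb]
  · intro a ha b hb
    simp only [Set.mem_setOf_eq, As_eq_one] at *
    apply lcancel (x := a)
    have := l_mul hcc x y a (ld a b)
    rw [mul_ld, ha, hb] at this
    rw [← this, mul_ld]
  · intro a ha b hb
    simp only [Set.mem_setOf_eq, As_eq_one] at *
    apply rcancel (x := b)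
    have := l_mul hcc x y (rd a b) b
    rw [rd_mul, ha, hb] at this
    rw [← this, rd_mul]

theorem closure_ind {S T : Set Q} (hT : IsSubloop T) (h : S ⊆ T) : closure S ⊆ T :=
  Set.sInter_subset_of_mem ⟨hT, h⟩

theorem subset_cl {S : Set Q} : S ⊆ closure S := Set.subset_sInter fun _ h => h.2

/-- If all triples of generators associate then the generated subloop is associative. -/
theorem gen_assoc (hcc : IsCC Q) (S : Set Q)
    (h : ∀ x ∈ S, ∀ y ∈ S, ∀ z ∈ S, As x y z = 1) :
    ∀ x ∈ closure S, ∀ y ∈ closure S, ∀ z ∈ closure S, As x y z = 1 := by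
  have h1 : ∀ x ∈ S, ∀ y ∈ S, ∀ z ∈ closure S, As x y z = 1 := fun x hx y hy z hz =>
    closure_ind (l_sub hcc x y) (h x hx y hy) hz
  have h2 : ∀ x ∈ S, ∀ z ∈ closure S, ∀ y ∈ closure S, As x z y = 1 := fun x hx z hz y hy =>
    closure_ind (l_sub hcc x z) (fun y hy => by
      show As x z y = 1
      rw [As_sym23 hcc]; exact h1 x hx y hy z hz) hy
  intro x hx y hy z hz
  have : As y z x = 1 := closure_ind (l_sub hcc y z) (fun x hx => by
      show As y z x = 1
      rw [As_sym23 hcc, As_sym12 hcc]; exact h2 x hx y hy z hz) hx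
  rw [As_sym12 hcc, As_sym23 hcc]; exact this

/-- multiplicativity of the associator, in conjugated form -/
theorem As_mul (hcc : IsCC Q) (x y z w : Q) :
    w * As x y (z * w) = As x y z * (w * As x y w) := by
  have h := l_mul hcc x y z w
  have h1 := As_mem hcc x y z
  have h3 := As_mem hcc x y (z * w)
  rw [As_spec, As_spec, As_spec, ← h1.2.1, ← h3.2.2] at h
  exact lcancel h

theorem As_xc (hcc : IsCC Q) {c : Q} (hwip : IsWIP c) (x : Q) : As x c (x * c) = 1 := by
  have h1 : l x c (ld (x * c) 1) = ld (x * c) 1 := by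
    apply lcancel (x := x * c)
    rw [l_spec, hwip, mul_ld, mul_ld]
  have h2 := l_mul hcc x c (x * c) (ld (x * c) 1)
  rw [mul_ld, l_one, h1] at h2
  rw [As_eq_one]
  apply rcancel (x := ld (x * c) 1)
  rw [← h2, mul_ld]

theorem As_cx (hcc : IsCC Q) {c : Q} (hwip : IsWIP c) (x : Q) : As x c (c * x) = 1 := by
  obtain ⟨k, hk, e⟩ := basarab2 hcc c x
  rw [e]
  exact (l_sub hcc x c).2.1 _ (As_xc hcc hwip x) _ (As_eq_one.2 (l_nuc hk x c))

theorem As_one (x y : Q) : As x y 1 = 1 := As_eq_one.2 (l_one x y)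

/-- inverse -/
theorem As_inv (hcc : IsCC Q) (u v x : Q) :
    As u v x * (ld x 1 * As u v (ld x 1)) = ld x 1 := by
  rw [← As_mul hcc, mul_ld, As_one, mul_one]

theorem As_pq (hcc : IsCC Q) {c : Q} (hwip : IsWIP c) (x : Q) : As x c x = As x c c := by
  have r1 := As_inv hcc x c x
  have r2 := As_inv hcc (ld x 1) c x
  have r3 := As_inv hcc c c x
  have r4 := As_mul hcc (ld x 1) c c (ld x 1)
  rw [As_cx hcc hwip, mul_one] at r4
  have s1 : As (ld x 1) c x = As x c (ld x 1) := by
    rw [As_sym23 hcc, As_sym12 hcc, As_sym23 hcc]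
  have s2 : As c c x = As x c c := by rw [As_sym23 hcc, As_sym12 hcc]
  have s3 : As c c (ld x 1) = As (ld x 1) c c := by rw [As_sym23 hcc, As_sym12 hcc]
  rw [s1] at r2
  rw [s2, s3] at r3
  have m1 := As_mem hcc x c x
  have m2 := As_mem hcc x c (ld x 1)
  have m3 := As_mem hcc (ld x 1) c (ld x 1)
  have m4 := As_mem hcc x c c
  have m5 := As_mem hcc (ld x 1) c c
  -- from r2 and r4 cancel
  have e1 : As x c (ld x 1) = As (ld x 1) c c := rcancel (r2.trans r4)
  rw [e1] at r1
  exact rcancel (r1.trans r3.symm)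

theorem As_pcp (hcc : IsCC Q) {c : Q} (hwip : IsWIP c) (x : Q) :
    As x c c * (c * As x c c) = c := by
  have := As_mul hcc x c x c
  rw [As_xc hcc hwip, mul_one, As_pq hcc hwip] at this
  exact this.symm

theorem As_xxcc (hcc : IsCC Q) {c : Q} (hwip : IsWIP c) (x : Q) : As x x (c * c) = 1 := by
  apply lcancel (x := c)
  rw [As_mul hcc, As_sym23 hcc x x c, As_pq hcc hwip, As_pcp hcc hwip, mul_one]

theorem As_xccc (hcc : IsCC Q) {c : Q} (hwip : IsWIP c) (x : Q) : As x c (c * c) = 1 := by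
  apply lcancel (x := c)
  rw [As_mul hcc, As_pcp hcc hwip, mul_one]

theorem As_xc2c2 (hcc : IsCC Q) {c : Q} (hwip : IsWIP c) (x : Q) :
    As x (c * c) (c * c) = 1 := by
  have h : As x (c * c) c = 1 := by rw [As_sym23 hcc, As_xccc hcc hwip]
  exact (l_sub hcc x (c * c)).2.1 _ h _ h

theorem assoc_iff {x y z : Q} : As x y z = 1 ↔ x * (y * z) = (x * y) * z := by
  rw [As_eq_one]
  constructor
  · intro h; rw [← l_spec, h]
  · intro h; apply lcancel (x := x * y); rw [l_spec, h]

theorem stmt15_aux (hcc : IsCC Q) (b c : Q) (hwip : IsWIP c) (hb : IsPA b) :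
    ∀ x ∈ closure {b, c * c}, ∀ y ∈ closure {b, c * c}, ∀ z ∈ closure {b, c * c},
      x * (y * z) = (x * y) * z := by
  have hb' : b ∈ closure ({b} : Set Q) := subset_cl rfl
  have hbbb : As b b b = 1 := assoc_iff.2 (hb b hb' b hb' b hb')
  have hbbc := As_xxcc hcc hwip b
  have h2 := As_xc2c2 hcc hwip
  intro x hx y hy z hz
  rw [← assoc_iff]
  refine gen_assoc hcc _ ?_ x hx y hy z hz
  rintro x (rfl | rfl) y (rfl | rfl) z (rfl | rfl)
  · exact hbbb
  · exact hbbc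
  · rw [As_sym23 hcc]; exact hbbc
  · exact h2 _
  · rw [As_sym12 hcc, As_sym23 hcc]; exact hbbc
  · rw [As_sym12 hcc]; exact h2 _
  · rw [As_sym23 hcc, As_sym12 hcc]; exact h2 _
  · exact h2 _

end aux
end Loop

open Loop

/-- In a CC-loop, if `c` is WIP and `b`, `c` are power-associative, then
`⟨b, c²⟩` is a group. -/
theorem stmt_15 {Q : Type*} [Loop Q] (hcc : IsCC Q) (b c : Q)
    (hwip : IsWIP c) (hb : IsPA b) (hc : IsPA c) :
    ∀ x ∈ closure {b, c * c}, ∀ y ∈ closure {b, c * c}, ∀ z ∈ closure {b, c * c},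
      x * (y * z) = (x * y) * z := by
  exact stmt15_aux hcc b c hwip hb
end
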